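/- arXiv:1405.5477 — 2 statements merged into one kernel-verified Lean document; each statement's English description precedes it below -/
import Mathlib

section
/- For every integer n ≥ 2, the number of (n−1)-tuples (t_1,…,t_{n−1}) of transpositions in the symmetric group S_n whose product t_1 t_2 ⋯ t_{n−1} equals the n-cycle (1 2 … n) is n^{n−2}. -/
section

open Equiv Equiv.Perm Finset

variable {α : Type*} [Fintype α] [DecidableEq α]

/-- The orbit of `x` under the permutation `σ`, as a finset. -/
def orbitFinset (σ : Perm α) (x : α) : Finset α :=
  univ.filter (fun y => SameCycle σ x y)

/-- The set of orbits of a permutation, fixed points included. -/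
def orbitClasses (σ : Perm α) : Finset (Finset α) := univ.image (orbitFinset σ)

/-- The product of the sizes of all orbits of a permutation. -/
def orbitProd (σ : Perm α) : ℚ := ∏ s ∈ orbitClasses σ, (s.card : ℚ)

theorem mem_orbitFinset {σ : Perm α} {x y : α} : y ∈ orbitFinset σ x ↔ SameCycle σ x y := by
  simp [orbitFinset]

theorem orbitFinset_eq_iff {σ : Perm α} {x y : α} :
    orbitFinset σ x = orbitFinset σ y ↔ SameCycle σ x y := by
  constructor
  · intro h
    rw [← mem_orbitFinset, h, mem_orbitFinset]
  · intro h
    ext z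
    simp only [mem_orbitFinset]
    exact ⟨fun h' => h.symm.trans h', fun h' => h.trans h'⟩

theorem orbitFinset_mem_orbitClasses (σ : Perm α) (x : α) :
    orbitFinset σ x ∈ orbitClasses σ := mem_image_of_mem _ (mem_univ x)

theorem card_orbitFinset_pos (σ : Perm α) (x : α) : 0 < (orbitFinset σ x).card :=
  card_pos.2 ⟨x, mem_orbitFinset.2 (SameCycle.refl σ x)⟩

theorem sum_inv_card_orbitFinset (σ : Perm α) :
    ∑ x, ((orbitFinset σ x).card : ℚ)⁻¹ = (orbitClasses σ).card := by
  rw [Finset.sum_comp (fun s : Finset α => ((s.card : ℚ))⁻¹) (orbitFinset σ), card_eq_sum_ones,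
    Nat.cast_sum]
  refine sum_congr rfl fun s hs => ?_
  obtain ⟨x, -, rfl⟩ := mem_image.1 hs
  have : (univ.filter fun a => orbitFinset σ a = orbitFinset σ x) = orbitFinset σ x := by
    ext y
    simp [orbitFinset_eq_iff, mem_orbitFinset, sameCycle_comm]
  rw [this, nsmul_eq_mul, Nat.cast_one, mul_inv_cancel₀]
  exact_mod_cast (card_orbitFinset_pos σ x).ne'

/-- An equivalence relation preserved by `σ` contains the orbit relation of `σ`. -/
theorem sameCycle_rel_of_forall {α : Type*} [Finite α] {σ : Perm α} (r : Setoid α)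
    (h : ∀ x, r x (σ x)) {x y : α}
    (hxy : SameCycle σ x y) : r x y := by
  obtain ⟨k, -, -, rfl⟩ := hxy.exists_pow_eq''
  clear hxy
  induction k with
  | zero => exact r.refl x
  | succ k ih =>
    rw [pow_succ', Perm.mul_apply]
    exact r.trans ih (h _)

theorem sameCycle_of_swap_mul {σ : Perm α} {a b x y : α} (hab : SameCycle σ a b)
    (h : SameCycle (swap a b * σ) x y) : SameCycle σ x y := by
  refine sameCycle_rel_of_forall (SameCycle.setoid σ) (fun z => ?_) h
  change SameCycle σ z (swap a b (σ z))
  have hz : SameCycle σ z (σ z) := sameCycle_apply_right.2 (SameCycle.refl σ z)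
  rcases eq_or_ne (σ z) a with h1 | h1
  · rw [h1, swap_apply_left]; exact (h1 ▸ hz).trans hab
  rcases eq_or_ne (σ z) b with h2 | h2
  · rw [h2, swap_apply_right]; exact (h2 ▸ hz).trans hab.symm
  rwa [swap_apply_of_ne_of_ne h1 h2]

theorem card_orbitClasses_le_of_sameCycle {σ : Perm α} {a b : α} (hab : SameCycle σ a b) :
    (orbitClasses σ).card ≤ (orbitClasses (swap a b * σ)).card := by
  refine card_le_card_of_surjOn (fun s => s.biUnion (orbitFinset σ)) ?_
  intro s hs
  obtain ⟨x, -, rfl⟩ := mem_image.1 hs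
  refine ⟨orbitFinset (swap a b * σ) x, orbitFinset_mem_orbitClasses _ x, ?_⟩
  ext z
  simp only [mem_biUnion, mem_orbitFinset]
  exact ⟨fun ⟨w, hw, hz⟩ => (sameCycle_of_swap_mul hab hw).trans hz,
    fun hz => ⟨x, SameCycle.refl _ x, hz⟩⟩

theorem sameCycle_swap_mul_left_right {σ : Perm α} {a b : α} (hab : ¬ SameCycle σ a b) :
    SameCycle (swap a b * σ) a b := by
  set l := Function.minimalPeriod σ a with hl
  have hpos : 0 < l := Function.minimalPeriod_pos_of_mem_periodicPts
    (Function.Injective.mem_periodicPts σ.injective a)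
  have key : ∀ j, j < l → ((swap a b * σ) ^ j) a = (σ ^ j) a := by
    intro j
    induction j with
    | zero => simp
    | succ j ih =>
      intro hj
      rw [pow_succ', Perm.mul_apply, ih (by omega), Perm.mul_apply, ← Perm.mul_apply σ, ← pow_succ',
        swap_apply_of_ne_of_ne]
      · intro h
        refine Function.not_isPeriodicPt_of_pos_of_lt_minimalPeriod (Nat.succ_ne_zero j) hj ?_
        rwa [Function.IsPeriodicPt, Function.IsFixedPt, Perm.iterate_eq_pow]
      · intro h
        exact hab ⟨(j + 1 : ℕ), by rw [zpow_natCast]; exact h⟩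
  refine ⟨(l : ℕ), ?_⟩
  rw [zpow_natCast]
  obtain ⟨j, hj⟩ : ∃ j, l = j + 1 := ⟨l - 1, by omega⟩
  rw [hj, pow_succ', Perm.mul_apply, key j (by omega), Perm.mul_apply, ← Perm.mul_apply σ,
    ← pow_succ', ← hj]
  have : (σ ^ l) a = a := by
    rw [← Perm.iterate_eq_pow]; exact Function.iterate_minimalPeriod
  rw [this, swap_apply_left]

theorem sameCycle_swap_mul_of_not_sameCycle {σ : Perm α} {a b x y : α} (hab : ¬ SameCycle σ a b)
    (h : SameCycle σ x y) : SameCycle (swap a b * σ) x y := by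
  refine sameCycle_rel_of_forall (SameCycle.setoid (swap a b * σ)) (fun z => ?_) h
  change SameCycle (swap a b * σ) z (σ z)
  have hz : SameCycle (swap a b * σ) z (swap a b (σ z)) :=
    sameCycle_apply_right.2 (SameCycle.refl (swap a b * σ) z)
  have hab' := sameCycle_swap_mul_left_right hab
  rcases eq_or_ne (σ z) a with h1 | h1
  · rw [h1, swap_apply_left] at hz; rw [h1]; exact hz.trans hab'.symm
  rcases eq_or_ne (σ z) b with h2 | h2
  · rw [h2, swap_apply_right] at hz; rw [h2]; exact hz.trans hab'
  rwa [swap_apply_of_ne_of_ne h1 h2] at hz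

theorem orbitFinset_swap_mul {σ : Perm α} {a b : α} (hab : ¬ SameCycle σ a b) (x : α) :
    orbitFinset (swap a b * σ) x =
      if SameCycle σ a x ∨ SameCycle σ b x then orbitFinset σ a ∪ orbitFinset σ b
      else orbitFinset σ x := by
  have hab' := sameCycle_swap_mul_left_right hab
  have hsub : ∀ {u v}, SameCycle σ u v → SameCycle (swap a b * σ) u v :=
    fun h => sameCycle_swap_mul_of_not_sameCycle hab h
  let f : α → Finset α := fun x => if SameCycle σ a x ∨ SameCycle σ b x then
    orbitFinset σ a ∪ orbitFinset σ b else orbitFinset σ x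
  have hf : ∀ {u v}, SameCycle σ u v → f u = f v := by
    intro u v h
    have h1 : SameCycle σ a u ↔ SameCycle σ a v := ⟨fun k => k.trans h, fun k => k.trans h.symm⟩
    have h2 : SameCycle σ b u ↔ SameCycle σ b v := ⟨fun k => k.trans h, fun k => k.trans h.symm⟩
    simp only [f, h1, h2, orbitFinset_eq_iff.2 h]
  have hfab : f a = f b := by simp [f, SameCycle.refl]
  have hmem : ∀ u, u ∈ f u := by
    intro u
    by_cases h : SameCycle σ a u ∨ SameCycle σ b u
    · simp only [f, h, if_true, mem_union, mem_orbitFinset]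
    · simp only [f, h, if_false, mem_orbitFinset, SameCycle.refl]
  have hff : ∀ {u v}, SameCycle (swap a b * σ) u v → f u = f v := by
    intro u v h
    refine sameCycle_rel_of_forall (Setoid.ker f) (fun z => ?_) h
    change f z = f (swap a b (σ z))
    have hz : f z = f (σ z) := hf (sameCycle_apply_right.2 (SameCycle.refl σ z))
    rcases eq_or_ne (σ z) a with h1 | h1
    · rw [hz, h1, swap_apply_left, hfab]
    rcases eq_or_ne (σ z) b with h2 | h2
    · rw [hz, h2, swap_apply_right, hfab]
    rw [hz, swap_apply_of_ne_of_ne h1 h2]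
  change _ = f x
  ext y
  rw [mem_orbitFinset]
  refine ⟨fun h => hff h ▸ hmem y, fun h => ?_⟩
  by_cases hx : SameCycle σ a x ∨ SameCycle σ b x
  · simp only [f, hx, if_true, mem_union, mem_orbitFinset] at h
    have h1 : SameCycle (swap a b * σ) a x := hx.elim hsub fun k => hab'.trans (hsub k)
    have h2 : SameCycle (swap a b * σ) a y := h.elim hsub fun k => hab'.trans (hsub k)
    exact h1.symm.trans h2
  · simp only [f, hx, if_false, mem_orbitFinset] at h
    exact hsub h

theorem orbitClasses_swap_mul {σ : Perm α} {a b : α} (hab : ¬ SameCycle σ a b) :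
    orbitClasses (swap a b * σ) = insert (orbitFinset σ a ∪ orbitFinset σ b)
      (((orbitClasses σ).erase (orbitFinset σ a)).erase (orbitFinset σ b)) := by
  ext s
  simp only [orbitClasses, mem_insert, mem_erase, mem_image, mem_univ, true_and,
    orbitFinset_swap_mul hab]
  constructor
  · rintro ⟨x, rfl⟩
    split_ifs with hx
    · exact Or.inl rfl
    · rw [not_or] at hx
      refine Or.inr ⟨fun h => hx.2 (orbitFinset_eq_iff.1 h).symm,
        fun h => hx.1 (orbitFinset_eq_iff.1 h).symm, x, rfl⟩
  · rintro (rfl | ⟨h1, h2, x, rfl⟩)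
    · exact ⟨a, by simp [SameCycle.refl]⟩
    · refine ⟨x, if_neg ?_⟩
      rintro (h | h)
      · exact h2 (orbitFinset_eq_iff.2 h.symm)
      · exact h1 (orbitFinset_eq_iff.2 h.symm)

theorem union_notMem_orbitClasses_erase {σ : Perm α} {a b : α} :
    orbitFinset σ a ∪ orbitFinset σ b ∉
      ((orbitClasses σ).erase (orbitFinset σ a)).erase (orbitFinset σ b) := by
  simp only [mem_erase, orbitClasses, mem_image, mem_univ, true_and, not_and, not_exists]
  intro _ h2 x hx
  refine h2 (hx ▸ orbitFinset_eq_iff.2 (mem_orbitFinset.1 ?_))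
  rw [hx]
  exact mem_union_left _ (mem_orbitFinset.2 (SameCycle.refl σ a))

theorem orbitFinset_right_mem_erase {σ : Perm α} {a b : α} (hab : ¬ SameCycle σ a b) :
    orbitFinset σ b ∈ (orbitClasses σ).erase (orbitFinset σ a) :=
  mem_erase.2 ⟨fun h => hab (orbitFinset_eq_iff.1 h).symm, orbitFinset_mem_orbitClasses σ b⟩

theorem card_orbitClasses_swap_mul {σ : Perm α} {a b : α} (hab : ¬ SameCycle σ a b) :
    (orbitClasses (swap a b * σ)).card + 1 = (orbitClasses σ).card := by
  rw [orbitClasses_swap_mul hab, card_insert_of_notMem union_notMem_orbitClasses_erase,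
    card_erase_add_one (orbitFinset_right_mem_erase hab),
    card_erase_add_one (orbitFinset_mem_orbitClasses σ a)]

theorem card_orbitClasses_swap_mul_add_one_eq_iff {σ : Perm α} {a b : α} :
    (orbitClasses (swap a b * σ)).card + 1 = (orbitClasses σ).card ↔ ¬ SameCycle σ a b := by
  refine ⟨fun h hab => ?_, card_orbitClasses_swap_mul⟩
  have := card_orbitClasses_le_of_sameCycle hab
  omega

theorem card_orbitClasses_le_swap_mul (σ : Perm α) (a b : α) :
    (orbitClasses σ).card ≤ (orbitClasses (swap a b * σ)).card + 1 := by
  by_cases hab : SameCycle σ a b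
  · exact (card_orbitClasses_le_of_sameCycle hab).trans (Nat.le_succ _)
  · exact (card_orbitClasses_swap_mul hab).ge

theorem orbitProd_swap_mul {σ : Perm α} {a b : α} (hab : ¬ SameCycle σ a b) :
    orbitProd (swap a b * σ) = orbitProd σ *
      (((orbitFinset σ a).card : ℚ)⁻¹ + ((orbitFinset σ b).card : ℚ)⁻¹) := by
  have hdisj : Disjoint (orbitFinset σ a) (orbitFinset σ b) := by
    rw [Finset.disjoint_left]
    intro x hx hx'
    exact hab ((mem_orbitFinset.1 hx).trans (mem_orbitFinset.1 hx').symm)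
  have ha : ((orbitFinset σ a).card : ℚ) ≠ 0 := by exact_mod_cast (card_orbitFinset_pos σ a).ne'
  have hb : ((orbitFinset σ b).card : ℚ) ≠ 0 := by exact_mod_cast (card_orbitFinset_pos σ b).ne'
  rw [orbitProd, orbitProd, orbitClasses_swap_mul hab,
    prod_insert union_notMem_orbitClasses_erase,
    ← mul_prod_erase _ _ (orbitFinset_mem_orbitClasses σ a),
    ← mul_prod_erase _ _ (orbitFinset_right_mem_erase hab), card_union_of_disjoint hdisj]
  push_cast
  field_simp
  ring

theorem sum_sum_orbitProd_swap_mul (σ : Perm α) :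
    ∑ a, ∑ b, (if SameCycle σ a b then 0 else orbitProd (swap a b * σ)) =
      2 * (Fintype.card α * ((orbitClasses σ).card - 1 : ℚ) * orbitProd σ) := by
  let w : α → ℚ := fun a => ((orbitFinset σ a).card : ℚ)⁻¹
  have h1 : ∀ a, ∑ b, (if SameCycle σ a b then 0 else w b) = (orbitClasses σ).card - 1 := by
    intro a
    have h2 : ∑ b, (if SameCycle σ a b then w b else 0) = 1 := by
      rw [← sum_filter]
      change ∑ b ∈ orbitFinset σ a, w b = 1
      rw [sum_congr rfl (g := fun _ => w a), sum_const, nsmul_eq_mul, mul_inv_cancel₀]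
      · exact_mod_cast (card_orbitFinset_pos σ a).ne'
      · intro b hb
        simp only [w, orbitFinset_eq_iff.2 (mem_orbitFinset.1 hb)]
    rw [← sum_inv_card_orbitFinset σ, eq_sub_iff_add_eq, ← h2, ← sum_add_distrib]
    refine sum_congr rfl fun b _ => ?_
    split_ifs <;> simp [w]
  have h2 : ∑ a, ∑ b, (if SameCycle σ a b then 0 else w b) =
      Fintype.card α * ((orbitClasses σ).card - 1 : ℚ) := by
    rw [sum_congr rfl fun a _ => h1 a, sum_const, nsmul_eq_mul, card_univ]
  have h3 : ∑ a, ∑ b, (if SameCycle σ a b then 0 else w a) =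
      Fintype.card α * ((orbitClasses σ).card - 1 : ℚ) := by
    rw [sum_comm, ← h2]
    simp only [sameCycle_comm]
  have h4 : ∀ a b, (if SameCycle σ a b then 0 else orbitProd (swap a b * σ)) =
      orbitProd σ * ((if SameCycle σ a b then 0 else w a) +
        (if SameCycle σ a b then 0 else w b)) := by
    intro a b
    split_ifs with h
    · simp
    · exact orbitProd_swap_mul h
  simp only [h4, ← mul_sum, sum_add_distrib, h2, h3]
  ring

variable (α) in
/-- The set of all transpositions. -/
def swapFinset : Finset (Perm α) := univ.offDiag.image fun p => swap p.1 p.2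

theorem mem_swapFinset {t : Perm α} : t ∈ swapFinset α ↔ t.IsSwap := by
  simp only [swapFinset, mem_image, mem_offDiag, mem_univ, true_and, Prod.exists, IsSwap]
  exact ⟨fun ⟨a, b, h, e⟩ => ⟨a, b, h, e.symm⟩, fun ⟨a, b, h, e⟩ => ⟨a, b, h, e.symm⟩⟩

theorem card_filter_swap_eq {a b : α} (hab : a ≠ b) :
    ((univ : Finset α).offDiag.filter fun p => swap p.1 p.2 = swap a b).card = 2 := by
  have : ((univ : Finset α).offDiag.filter fun p => swap p.1 p.2 = swap a b) =
      {(a, b), (b, a)} := by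
    ext ⟨x, y⟩
    simp only [mem_filter, mem_offDiag, mem_univ, true_and, mem_insert, mem_singleton,
      Prod.mk.injEq]
    constructor
    · rintro ⟨hxy, h⟩
      have h1 : swap a b x = y := by rw [← h, swap_apply_left]
      rcases eq_or_ne x a with rfl | hxa
      · exact Or.inl ⟨rfl, by rw [← h1, swap_apply_left]⟩
      rcases eq_or_ne x b with rfl | hxb
      · exact Or.inr ⟨rfl, by rw [← h1, swap_apply_right]⟩
      · rw [swap_apply_of_ne_of_ne hxa hxb] at h1
        exact absurd h1 hxy
    · rintro (⟨rfl, rfl⟩ | ⟨rfl, rfl⟩)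
      · exact ⟨hab, rfl⟩
      · exact ⟨hab.symm, swap_comm _ _⟩
  rw [this, card_pair]
  simp [hab]

theorem two_mul_sum_swapFinset (f : Perm α → ℚ) :
    2 * ∑ t ∈ swapFinset α, f t = ∑ p ∈ (univ : Finset α).offDiag, f (swap p.1 p.2) := by
  rw [Finset.sum_comp f fun p : α × α => swap p.1 p.2, mul_sum]
  refine sum_congr rfl fun t ht => ?_
  obtain ⟨a, b, hab, rfl⟩ := mem_swapFinset.1 ht
  rw [card_filter_swap_eq hab, nsmul_eq_mul, Nat.cast_ofNat]

theorem sum_swapFinset_orbitProd (σ : Perm α) :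
    ∑ t ∈ swapFinset α,
      (if (orbitClasses (t * σ)).card + 1 = (orbitClasses σ).card then orbitProd (t * σ) else 0) =
      Fintype.card α * ((orbitClasses σ).card - 1 : ℚ) * orbitProd σ := by
  refine mul_left_cancel₀ (two_ne_zero (α := ℚ)) ?_
  rw [two_mul_sum_swapFinset, ← sum_sum_orbitProd_swap_mul, ← sum_product', univ_product_univ]
  simp only [card_orbitClasses_swap_mul_add_one_eq_iff, ite_not]
  refine sum_subset (subset_univ _) fun p _ hp => if_pos ?_
  have : p.1 = p.2 := by simpa using hp
  rw [this]

/-- The number of ways to write `σ` as a product of `m` transpositions. -/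
def swapFactorizations : ℕ → Perm α → ℕ
  | 0, σ => if σ = 1 then 1 else 0
  | m + 1, σ => ∑ t ∈ swapFinset α, swapFactorizations m (t * σ)

theorem card_le_of_swapFactorizations_ne_zero {m : ℕ} {σ : Perm α}
    (h : swapFactorizations m σ ≠ 0) : Fintype.card α ≤ (orbitClasses σ).card + m := by
  induction m generalizing σ with
  | zero =>
    have h1 : σ = 1 := by by_contra h1; simp [swapFactorizations, h1] at h
    subst h1
    rw [orbitClasses, card_image_of_injective]
    · simp
    · intro x y hxy
      simpa using orbitFinset_eq_iff.1 hxy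
  | succ m ih =>
    obtain ⟨t, ht, h⟩ := exists_ne_zero_of_sum_ne_zero h
    obtain ⟨a, b, -, rfl⟩ := mem_swapFinset.1 ht
    have h1 := ih h
    have h2 := card_orbitClasses_le_swap_mul (swap a b * σ) a b
    rw [swap_mul_self_mul] at h2
    omega

/-- The factorizations of length `m` into transpositions that merge two orbits at each step,
weighted by the product of the orbit sizes of the resulting permutation. -/
def weightedFactorizations (α : Type*) [Fintype α] [DecidableEq α] (m : ℕ) : ℚ :=
  ∑ σ : Perm α, if (orbitClasses σ).card + m = Fintype.card α then
    swapFactorizations m σ * orbitProd σ else 0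

theorem orbitFinset_one (x : α) : orbitFinset (1 : Perm α) x = {x} := by
  ext y
  simp [mem_orbitFinset, eq_comm]

theorem orbitClasses_one : orbitClasses (1 : Perm α) = univ.image singleton :=
  image_congr fun x _ => orbitFinset_one x

theorem weightedFactorizations_zero : weightedFactorizations α 0 = 1 := by
  rw [weightedFactorizations, sum_eq_single 1]
  · simp [swapFactorizations, orbitProd, orbitClasses_one, card_image_of_injective,
      singleton_injective, prod_image]
  · intro σ _ hσ
    simp [swapFactorizations, hσ]
  · simp

theorem weightedFactorizations_succ (m : ℕ) :
    weightedFactorizations α (m + 1) =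
      weightedFactorizations α m * (Fintype.card α * (Fintype.card α - (m + 1 : ℕ) : ℚ)) := by
  have h1 : weightedFactorizations α (m + 1) = ∑ t ∈ swapFinset α, ∑ σ : Perm α,
      if (orbitClasses (t * σ)).card + (m + 1) = Fintype.card α then
        swapFactorizations m σ * orbitProd (t * σ) else 0 := by
    rw [weightedFactorizations]
    have h2 : ∀ t ∈ swapFinset α, (∑ σ : Perm α,
        if (orbitClasses (t * σ)).card + (m + 1) = Fintype.card α then
          swapFactorizations m σ * orbitProd (t * σ) else 0) = ∑ σ : Perm α,
        if (orbitClasses σ).card + (m + 1) = Fintype.card α then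
          swapFactorizations m (t * σ) * orbitProd σ else 0 := by
      intro t ht
      refine Fintype.sum_equiv (Equiv.mulLeft t) _ _ fun σ => ?_
      obtain ⟨a, b, -, rfl⟩ := mem_swapFinset.1 ht
      simp only [Equiv.coe_mulLeft, swap_mul_self_mul]
    rw [sum_congr rfl h2, sum_comm]
    refine sum_congr rfl fun σ _ => ?_
    split_ifs
    · rw [swapFactorizations, Nat.cast_sum, sum_mul]
    · simp
  rw [h1, sum_comm, weightedFactorizations, sum_mul]
  refine sum_congr rfl fun σ _ => ?_
  by_cases h0 : swapFactorizations m σ = 0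
  · simp [h0]
  have hle := card_le_of_swapFactorizations_ne_zero h0
  by_cases hm : (orbitClasses σ).card + m = Fintype.card α
  · have h3 : ∀ t : Perm α, (orbitClasses (t * σ)).card + (m + 1) = Fintype.card α ↔
        (orbitClasses (t * σ)).card + 1 = (orbitClasses σ).card := fun t => by omega
    have h4 : ((orbitClasses σ).card : ℚ) - 1 = Fintype.card α - (m + 1 : ℕ) := by
      rw [← hm]; push_cast; ring
    simp only [h3, hm, if_true, ← mul_ite_zero, ← mul_sum]
    rw [sum_swapFinset_orbitProd, h4]
    ring
  · rw [if_neg hm, zero_mul]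
    refine sum_eq_zero fun t ht => if_neg ?_
    obtain ⟨a, b, -, rfl⟩ := mem_swapFinset.1 ht
    have := card_orbitClasses_le_swap_mul σ a b
    omega

theorem weightedFactorizations_eq (m : ℕ) (hm : m + 1 ≤ Fintype.card α) :
    weightedFactorizations α m * (Fintype.card α - (m + 1)).factorial =
      (Fintype.card α : ℚ) ^ m * (Fintype.card α - 1).factorial := by
  induction m with
  | zero => simp [weightedFactorizations_zero]
  | succ m ih =>
    have h1 := ih (by omega)
    obtain ⟨k, hk⟩ : ∃ k, Fintype.card α = k + (m + 1 + 1) := ⟨_, (Nat.sub_add_cancel hm).symm⟩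
    have h2 : Fintype.card α - (m + 1) = k + 1 := by omega
    have h3 : Fintype.card α - (m + 1 + 1) = k := by omega
    have h4 : (Fintype.card α : ℚ) - (m + 1 : ℕ) = (k + 1 : ℕ) := by rw [hk]; push_cast; ring
    rw [h2, Nat.factorial_succ, Nat.cast_mul] at h1
    rw [h3, weightedFactorizations_succ, h4, pow_succ, mul_right_comm _ (Fintype.card α : ℚ),
      ← h1]
    ring

theorem swapFactorizations_conj (m : ℕ) (h σ : Perm α) :
    swapFactorizations m (h * σ * h⁻¹) = swapFactorizations m σ := by
  induction m generalizing σ with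
  | zero => simp [swapFactorizations]
  | succ m ih =>
    rw [swapFactorizations, swapFactorizations]
    refine (sum_equiv (MulAut.conj h).toEquiv (fun t => ?_) fun t _ => ?_).symm
    · simp only [mem_swapFinset, MulEquiv.toEquiv_eq_coe, EquivLike.coe_coe, MulAut.conj_apply]
      constructor
      · rintro ⟨a, b, hab, rfl⟩
        exact ⟨h a, h b, h.injective.ne hab, by rw [swap_apply_apply]⟩
      · rintro ⟨a, b, hab, e⟩
        refine ⟨h⁻¹ a, h⁻¹ b, h⁻¹.injective.ne hab, ?_⟩
        rw [swap_apply_apply, ← e]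
        group
    · rw [← ih]
      congr 1
      simp only [MulEquiv.toEquiv_eq_coe, EquivLike.coe_coe, MulAut.conj_apply]
      group

theorem card_orbitClasses_eq_one_iff [Nontrivial α] {σ : Perm α} :
    (orbitClasses σ).card = 1 ↔ σ.cycleType = {Fintype.card α} := by
  have h1 : (orbitClasses σ).card = 1 ↔ ∀ x y, SameCycle σ x y := by
    rw [card_eq_one]
    constructor
    · rintro ⟨s, hs⟩ x y
      have h : ∀ z, orbitFinset σ z = s := fun z =>
        mem_singleton.1 (hs ▸ orbitFinset_mem_orbitClasses σ z)
      exact orbitFinset_eq_iff.1 ((h x).trans (h y).symm)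
    · intro h
      obtain ⟨x⟩ : Nonempty α := inferInstance
      refine ⟨orbitFinset σ x, eq_singleton_iff_unique_mem.2
        ⟨orbitFinset_mem_orbitClasses σ x, fun s hs => ?_⟩⟩
      obtain ⟨y, -, rfl⟩ := mem_image.1 hs
      exact orbitFinset_eq_iff.2 (h y x)
  rw [h1]
  constructor
  · intro h
    have hne : ∀ x, σ x ≠ x := by
      intro x hx
      obtain ⟨y, hy⟩ := exists_ne x
      exact hy ((h x y).eq_of_left hx).symm
    obtain ⟨x⟩ : Nonempty α := inferInstance
    have hc : IsCycle σ := ⟨x, hne x, fun y _ => h x y⟩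
    rw [hc.cycleType, eq_univ_iff_forall.2 fun x => mem_support.2 (hne x), card_univ]
  · intro h x y
    have hc : IsCycle σ := by
      rw [← card_cycleType_eq_one, h, Multiset.card_singleton]
    have hs : σ.support = univ := by
      rw [← card_eq_iff_eq_univ, ← sum_cycleType, h, Multiset.sum_singleton]
    have hne : ∀ x, σ x ≠ x := fun x => mem_support.1 (hs ▸ mem_univ x)
    exact hc.sameCycle (hne x) (hne y)

theorem card_filter_cycleType_eq [Nontrivial α] :
    (univ.filter fun σ : Perm α => σ.cycleType = {Fintype.card α}).card =
      (Fintype.card α - 1).factorial := by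
  have h := card_of_cycleType_mul_eq α {Fintype.card α}
  have hpos : 0 < Fintype.card α := Fintype.card_pos
  have h2 : 1 < Fintype.card α := Fintype.one_lt_card
  rw [if_pos ⟨by simp, fun a ha => Multiset.mem_singleton.1 ha ▸ h2⟩] at h
  simp only [Multiset.sum_singleton, Nat.sub_self, Nat.factorial_zero, one_mul,
    Multiset.prod_singleton, Multiset.toFinset_singleton, prod_singleton,
    Multiset.count_singleton_self, Nat.factorial_one, mul_one] at h
  rw [← Nat.mul_factorial_pred hpos.ne', mul_comm] at h
  exact Nat.eq_of_mul_eq_mul_left hpos h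

/-- **Dénes' theorem**: the number of factorizations of a full cycle into the minimal number of
transpositions. -/
theorem swapFactorizations_of_cycleType [Nontrivial α] {c : Perm α}
    (hc : c.cycleType = {Fintype.card α}) :
    swapFactorizations (Fintype.card α - 1) c = Fintype.card α ^ (Fintype.card α - 2) := by
  have h2 : 2 ≤ Fintype.card α := Fintype.one_lt_card
  have hN := weightedFactorizations_eq (α := α) (Fintype.card α - 1) (by omega)
  have hsum : weightedFactorizations α (Fintype.card α - 1) =
      (Fintype.card α - 1).factorial *
        (swapFactorizations (Fintype.card α - 1) c * Fintype.card α) := by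
    rw [weightedFactorizations, ← card_filter_cycleType_eq, ← nsmul_eq_mul, ← sum_const,
      sum_filter]
    refine sum_congr rfl fun σ _ => ?_
    have h3 : (orbitClasses σ).card + (Fintype.card α - 1) = Fintype.card α ↔
        σ.cycleType = {Fintype.card α} := by
      rw [← card_orbitClasses_eq_one_iff]; omega
    simp only [h3]
    split_ifs with hσ
    · obtain ⟨g, rfl⟩ := isConj_iff.1 (isConj_iff_cycleType_eq.2 (hc.trans hσ.symm))
      rw [swapFactorizations_conj]
      congr 1
      obtain ⟨s, hs⟩ := card_eq_one.1 (card_orbitClasses_eq_one_iff.2 hσ)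
      have hall : ∀ z, orbitFinset (g * c * g⁻¹) z = s := fun z =>
        mem_singleton.1 (hs ▸ orbitFinset_mem_orbitClasses _ z)
      have hs' : s = univ := eq_univ_iff_forall.2 fun z =>
        hall z ▸ mem_orbitFinset.2 (SameCycle.refl _ z)
      rw [orbitProd, hs, prod_singleton, hs', card_univ]
    · rfl
  rw [hsum, show Fintype.card α - (Fintype.card α - 1 + 1) = 0 by omega, Nat.factorial_zero,
    Nat.cast_one, mul_one, show Fintype.card α - 1 = Fintype.card α - 2 + 1 by omega, pow_succ,
    ← Nat.cast_pow] at hN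
  norm_cast at hN
  rw [mul_comm] at hN
  have h3 := Nat.eq_of_mul_eq_mul_right (Nat.factorial_pos _) hN
  rw [show Fintype.card α - 1 = Fintype.card α - 2 + 1 by omega]
  exact Nat.eq_of_mul_eq_mul_right (by omega) h3

theorem card_isSwap_tuples_eq_swapFactorizations (m : ℕ) (σ : Perm α) :
    Nat.card {t : Fin m → Perm α // (∀ i, (t i).IsSwap) ∧ (List.ofFn t).prod = σ} =
      swapFactorizations m σ := by
  induction m generalizing σ with
  | zero =>
    rw [swapFactorizations]
    split_ifs with h
    · subst h
      simp
    · have : IsEmpty {t : Fin 0 → Perm α // (∀ i, (t i).IsSwap) ∧ (List.ofFn t).prod = σ} :=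
        ⟨fun t => h (by simpa using t.2.2.symm)⟩
      exact Nat.card_of_isEmpty
  | succ m ih =>
    have e : {t : Fin (m + 1) → Perm α // (∀ i, (t i).IsSwap) ∧ (List.ofFn t).prod = σ} ≃
        Σ s : swapFinset α, {t : Fin m → Perm α //
          (∀ i, (t i).IsSwap) ∧ (List.ofFn t).prod = s * σ} :=
      { toFun := fun t => ⟨⟨t.1 0, mem_swapFinset.2 (t.2.1 0)⟩, fun i => t.1 i.succ,
          fun i => t.2.1 i.succ, by
            obtain ⟨t, h, rfl⟩ := t
            obtain ⟨a, b, -, hab⟩ := h 0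
            simp only [List.ofFn_succ, List.prod_cons, hab, swap_mul_self_mul]⟩
        invFun := fun p => ⟨Fin.cons p.1.1 p.2.1,
          Fin.cases (mem_swapFinset.1 p.1.2) p.2.2.1, by
            obtain ⟨⟨s, hs⟩, t, h, ht⟩ := p
            obtain ⟨a, b, -, rfl⟩ := mem_swapFinset.1 hs
            simp only [List.ofFn_succ, List.prod_cons, Fin.cons_zero, Fin.cons_succ, ht,
              swap_mul_self_mul]⟩
        left_inv := fun t => Subtype.ext (Fin.cons_self_tail t.1)
        right_inv := fun p => rfl }
    rw [Nat.card_congr e, Nat.card_sigma, swapFactorizations, ← sum_coe_sort (swapFinset α)]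
    exact sum_congr rfl fun s _ => ih _

end

/-- The number of `(n-1)`-tuples `(t_1, …, t_{n-1})` of transpositions in the
symmetric group `S_n` whose product `t_1 t_2 ⋯ t_{n-1}` is the `n`-cycle
`(1 2 … n)` equals `n^(n-2)`. -/
theorem stmt2 (n : ℕ) (hn : 2 ≤ n) :
    Nat.card {t : Fin (n - 1) → Equiv.Perm (Fin n) //
        (∀ i, (t i).IsSwap) ∧ (List.ofFn t).prod = finRotate n}
      = n ^ (n - 2) := by
  have : Nontrivial (Fin n) := Fin.nontrivial_iff_two_le.2 hn
  have h := swapFactorizations_of_cycleType (c := finRotate n)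
    (by rw [cycleType_finRotate_of_le hn, Fintype.card_fin])
  rw [Fintype.card_fin] at h
  rw [card_isSwap_tuples_eq_swapFactorizations, h]
end

section
/- For every integer n ≥ 1, the polynomial identity ∏_{i=1}^{n} (i + q(n−i)) = Σ_{(T,v*) ∈ 𝒜*_n} ∏_{v internal vertex of T} β(v) holds, where the sum is over all pointed André trees on n vertices. -/
open scoped Classical

noncomputable section

/-- An André tree on `n` vertices, encoded by its parent map `p` on `Fin n`
(vertex `i` stands for label `i+1`): every non-root vertex points to a strictly
larger parent, the root (label `n`) is a fixed point by convention, and each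
vertex has at most two children. -/
def IsAndreTree (n : ℕ) (p : Fin n → Fin n) : Prop :=
  (∀ i : Fin n, (i : ℕ) + 1 < n → (i : ℕ) < (p i : ℕ)) ∧
  (∀ i : Fin n, ¬ (i : ℕ) + 1 < n → p i = i) ∧
  ∀ j : Fin n, (Finset.univ.filter fun i : Fin n => (i : ℕ) + 1 < n ∧ p i = j).card ≤ 2

/-- The set of André trees on `n` vertices. -/
def andreTrees (n : ℕ) : Finset (Fin n → Fin n) :=
  Finset.univ.filter (IsAndreTree n)

/-- The hook length of the vertex `v`: the number of vertices in the subtree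
rooted at `v`, i.e. the number of vertices `w` having `v` as an ancestor. -/
def hookA (n : ℕ) (p : Fin n → Fin n) (v : Fin n) : ℕ :=
  (Finset.univ.filter fun w : Fin n => ∃ k < n, p^[k] w = v).card

/-- The set of internal vertices, i.e. vertices with hook length `> 1`. -/
def internalsA (n : ℕ) (p : Fin n → Fin n) : Finset (Fin n) :=
  Finset.univ.filter fun v => 1 < hookA n p v

/-- The number of children of the vertex `v`. -/
def childCount (n : ℕ) (p : Fin n → Fin n) (v : Fin n) : ℕ :=
  (Finset.univ.filter fun i : Fin n => (i : ℕ) + 1 < n ∧ p i = v).card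

/-- The set of pointed André trees on `n` vertices: an André tree together with a
distinguished vertex having at most one child. -/
def pointedAndreTrees (n : ℕ) : Finset ((Fin n → Fin n) × Fin n) :=
  (andreTrees n ×ˢ Finset.univ).filter fun x => childCount n x.1 x.2 ≤ 1

/-- `v` lies on the path from the root to the distinguished vertex `vstar`
(endpoints included), i.e. `v` is an ancestor of `vstar` (or `vstar` itself). -/
def OnPath (n : ℕ) (p : Fin n → Fin n) (vstar v : Fin n) : Prop :=
  ∃ k < n, p^[k] vstar = v

end

/-! ### A Rothe–Hagen convolution -/

/-- The product `∏_{i=1}^{n} (x + q n + i (1 - q))`. -/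
def rotheProd (q : ℚ) (n : ℕ) (x : ℚ) : ℚ :=
  ∏ i ∈ Finset.range n, (x + q * n + (i + 1) * (1 - q))

/-- The binomial-type companion `x ∏_{i=1}^{n-1} (x + q n + i (1 - q))` of `rotheProd`. -/
def rothePoly (q : ℚ) : ℕ → ℚ → ℚ
  | 0, _ => 1
  | n + 1, x => x * rotheProd q n (x + q)

theorem rotheProd_succ (q : ℚ) (n : ℕ) (x : ℚ) :
    rotheProd q (n + 1) x = rothePoly q (n + 1) x + (n + 1) * rotheProd q n (x + q) := by
  have h : rotheProd q n (x + q)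
      = ∏ i ∈ Finset.range n, (x + q * (n + 1 : ℕ) + (i + 1) * (1 - q)) :=
    Finset.prod_congr rfl fun i _ => by push_cast; ring
  rw [rothePoly, rotheProd, Finset.prod_range_succ, h]
  push_cast
  ring

theorem sum_antidiagonal_mul_fst (n : ℕ) (a b : ℕ → ℚ) :
    ∑ k ∈ Finset.HasAntidiagonal.antidiagonal (n + 1), ((n + 1).choose k.1 : ℚ) * (k.1 * a k.1 * b k.2)
      = (n + 1) * ∑ k ∈ Finset.HasAntidiagonal.antidiagonal n, (n.choose k.1 : ℚ) * (a (k.1 + 1) * b k.2) := by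
  rw [Finset.Nat.sum_antidiagonal_succ, Finset.mul_sum]
  simp only [Nat.cast_zero, zero_mul, mul_zero, zero_add]
  refine Finset.sum_congr rfl fun k _ => ?_
  have h : ((n + 1 : ℕ) : ℚ) * n.choose k.1 = (n + 1).choose (k.1 + 1) * (k.1 + 1 : ℕ) := by
    exact_mod_cast Nat.add_one_mul_choose_eq n k.1
  push_cast at h ⊢
  linear_combination -(a (k.1 + 1) * b k.2) * h

theorem sum_antidiagonal_choose_swap (n : ℕ) (F : ℕ → ℕ → ℚ) :
    ∑ k ∈ Finset.HasAntidiagonal.antidiagonal n, (n.choose k.1 : ℚ) * F k.1 k.2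
      = ∑ k ∈ Finset.HasAntidiagonal.antidiagonal n, (n.choose k.1 : ℚ) * F k.2 k.1 := by
  rw [← Finset.Nat.sum_antidiagonal_swap]
  refine Finset.sum_congr rfl fun k hk => ?_
  rw [Nat.choose_symm_of_eq_add (Finset.HasAntidiagonal.mem_antidiagonal.1 hk).symm]
  simp

theorem rothePoly_convolution_aux (q : ℚ) (n : ℕ)
    (ih : ∀ x y, ∑ k ∈ Finset.HasAntidiagonal.antidiagonal n,
      (n.choose k.1 : ℚ) * (rotheProd q k.1 x * rothePoly q k.2 y) = rotheProd q n (x + y))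
    (x y : ℚ) :
    ∑ k ∈ Finset.HasAntidiagonal.antidiagonal (n + 1),
      ((n + 1).choose k.1 : ℚ) * (k.1 * rothePoly q k.1 x * rothePoly q k.2 y)
        = (n + 1) * (x * rotheProd q n (x + y + q)) := by
  rw [sum_antidiagonal_mul_fst n (rothePoly q · x) (rothePoly q · y),
    show x + y + q = x + q + y by ring, ← ih, Finset.mul_sum _ _ x]
  congr 1
  refine Finset.sum_congr rfl fun k _ => ?_
  rw [rothePoly]
  ring

theorem rothePoly_convolution_of_rotheProd (q : ℚ) (n : ℕ)
    (ih : ∀ x y, ∑ k ∈ Finset.HasAntidiagonal.antidiagonal n,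
      (n.choose k.1 : ℚ) * (rotheProd q k.1 x * rothePoly q k.2 y) = rotheProd q n (x + y))
    (x y : ℚ) :
    ∑ k ∈ Finset.HasAntidiagonal.antidiagonal (n + 1),
      ((n + 1).choose k.1 : ℚ) * (rothePoly q k.1 x * rothePoly q k.2 y)
        = rothePoly q (n + 1) (x + y) := by
  have h1 := rothePoly_convolution_aux q n ih x y
  have h2 := rothePoly_convolution_aux q n ih y x
  rw [sum_antidiagonal_choose_swap (n + 1)
    (fun i j => (i : ℚ) * rothePoly q i y * rothePoly q j x), add_comm y x] at h2
  have hn : ((n : ℚ) + 1) ≠ 0 := by positivity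
  apply mul_left_cancel₀ hn
  rw [rothePoly]
  have h3 := congrArg₂ (· + ·) h1 h2
  simp only [← Finset.sum_add_distrib] at h3
  rw [Finset.mul_sum]
  refine Eq.trans (Finset.sum_congr rfl fun k hk => ?_) (h3.trans (by ring))
  have hk' : (k.1 : ℚ) + k.2 = n + 1 := by exact_mod_cast Finset.HasAntidiagonal.mem_antidiagonal.1 hk
  rw [← hk']
  ring

theorem rotheProd_convolution (q : ℚ) (n : ℕ) (x y : ℚ) :
    ∑ k ∈ Finset.HasAntidiagonal.antidiagonal n,
      (n.choose k.1 : ℚ) * (rotheProd q k.1 x * rothePoly q k.2 y) = rotheProd q n (x + y) := by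
  induction n generalizing x y with
  | zero => simp [rotheProd, rothePoly]
  | succ n ih =>
    have h := sum_antidiagonal_mul_fst n (fun i => rotheProd q (i - 1) (x + q)) (rothePoly q · y)
    simp only [Nat.add_sub_cancel] at h
    rw [rotheProd_succ, ← rothePoly_convolution_of_rotheProd q n ih,
      show x + y + q = x + q + y by ring, ← ih, ← h, ← Finset.sum_add_distrib]
    refine Finset.sum_congr rfl fun k _ => ?_
    rcases k with ⟨_ | k, l⟩
    · simp [rotheProd, rothePoly]
    · simp only [rotheProd_succ, Nat.add_sub_cancel]
      push_cast
      ring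

theorem rothePoly_convolution (q : ℚ) (n : ℕ) (x y : ℚ) :
    ∑ k ∈ Finset.HasAntidiagonal.antidiagonal n,
      (n.choose k.1 : ℚ) * (rothePoly q k.1 x * rothePoly q k.2 y) = rothePoly q n (x + y) := by
  cases n with
  | zero => simp [rothePoly]
  | succ n => exact rothePoly_convolution_of_rotheProd q n (rotheProd_convolution q n) x y

theorem two_mul_rothePoly_one_succ (q : ℚ) (n : ℕ) (hn : n ≠ 0) :
    2 * rothePoly q (n + 1) 1 = (2 + q * n) * rothePoly q n 2 := by
  obtain ⟨n, rfl⟩ := Nat.exists_eq_succ_of_ne_zero hn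
  simp only [Nat.succ_eq_add_one, rothePoly, rotheProd]
  rw [Finset.prod_range_succ']
  have : ∏ k ∈ Finset.range n,
      (1 + q + q * ((n + 1 : ℕ) : ℚ) + (((k + 1 : ℕ) : ℚ) + 1) * (1 - q))
      = ∏ i ∈ Finset.range n, (2 + q + q * (n : ℚ) + ((i : ℚ) + 1) * (1 - q)) :=
    Finset.prod_congr rfl fun i _ => by push_cast; ring
  rw [this]
  push_cast
  ring

theorem rotheProd_zero_succ (q : ℚ) (n : ℕ) :
    rotheProd q (n + 1) 0 = (1 + q * n) * rotheProd q n 1 := by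
  simp only [rotheProd]
  rw [Finset.prod_range_succ']
  have : ∏ k ∈ Finset.range n,
      (0 + q * ((n + 1 : ℕ) : ℚ) + (((k + 1 : ℕ) : ℚ) + 1) * (1 - q))
      = ∏ i ∈ Finset.range n, (1 + q * (n : ℚ) + ((i : ℚ) + 1) * (1 - q)) :=
    Finset.prod_congr rfl fun i _ => by push_cast; ring
  rw [this]
  push_cast
  ring

theorem rotheProd_zero (q : ℚ) (n : ℕ) :
    rotheProd q n 0 = ∏ i ∈ Finset.Icc 1 n, ((i : ℚ) + q * ((n : ℚ) - (i : ℚ))) := by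
  rw [rotheProd, ← Finset.Ico_add_one_right_eq_Icc, Finset.prod_Ico_eq_prod_range]
  exact Finset.prod_congr rfl fun i _ => by push_cast; ring

/-! ### Decreasing trees on a finite set of vertices -/

section Trees

set_option linter.unusedSectionVars false

variable {ι : Type*} [Fintype ι] [LinearOrder ι]

/-- The vertices other than `j` that `p` maps to `j`. -/
def childrenOf (p : ι → ι) (j : ι) : Finset ι :=
  Finset.univ.filter fun i => p i = j ∧ i ≠ j

/-- Some iterate of `p` maps `w` to `v`. -/
def Reaches (p : ι → ι) (w v : ι) : Prop :=
  ∃ k, p^[k] w = v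

/-- The number of vertices that reach `v`. -/
noncomputable def hookOf (p : ι → ι) (v : ι) : ℕ :=
  (Finset.univ.filter fun w => Reaches p w v).card

/-- The parent maps of decreasing trees on `S` with at most two children per vertex. The root is
the fixed point of `p` in `S`, and vertices outside `S` are fixed; the empty tree is allowed. -/
structure IsTreeOn (S : Finset ι) (p : ι → ι) : Prop where
  fixed : ∀ i ∉ S, p i = i
  maps : ∀ i ∈ S, p i ∈ S
  le : ∀ i, i ≤ p i
  unique : ∀ i ∈ S, ∀ j ∈ S, p i = i → p j = j → i = j
  card_le : ∀ j, (childrenOf p j).card ≤ 2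

/-- The finset of parent maps of trees on `S`. -/
noncomputable def treesOn (S : Finset ι) : Finset (ι → ι) :=
  Finset.univ.filter (IsTreeOn S)

theorem mem_treesOn {S : Finset ι} {p : ι → ι} : p ∈ treesOn S ↔ IsTreeOn S p := by
  simp [treesOn]

theorem mem_childrenOf {p : ι → ι} {i j : ι} : i ∈ childrenOf p j ↔ p i = j ∧ i ≠ j := by
  simp [childrenOf]

theorem Reaches.refl (p : ι → ι) (w : ι) : Reaches p w w := ⟨0, rfl⟩

theorem reaches_iff (p : ι → ι) (w v : ι) : Reaches p w v ↔ w = v ∨ Reaches p (p w) v := by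
  constructor
  · rintro ⟨_ | k, h⟩
    · exact Or.inl h
    · exact Or.inr ⟨k, h⟩
  · rintro (rfl | ⟨k, h⟩)
    · exact Reaches.refl p w
    · exact ⟨k + 1, h⟩

theorem reaches_iff_eq {p : ι → ι} {w : ι} (h : p w = w) (v : ι) : Reaches p w v ↔ w = v := by
  refine ⟨?_, fun h => h ▸ Reaches.refl p w⟩
  rintro ⟨k, hk⟩
  rwa [Function.iterate_fixed h] at hk

namespace IsTreeOn

variable {S : Finset ι} {p : ι → ι}

theorem mem_of_reaches (hp : IsTreeOn S p) {w v : ι} (hw : w ∈ S) (h : Reaches p w v) :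
    v ∈ S := by
  obtain ⟨k, rfl⟩ := h
  induction k generalizing w with
  | zero => exact hw
  | succ k ih => exact ih (hp.maps w hw)

theorem mem_of_reaches_mem (hp : IsTreeOn S p) {w v : ι} (hv : v ∈ S) (h : Reaches p w v) :
    w ∈ S := by
  by_contra hw
  rw [reaches_iff_eq (hp.fixed w hw)] at h
  exact hw (h ▸ hv)

theorem exists_root (hp : IsTreeOn S p) {w : ι} (hw : w ∈ S) :
    ∃ r ∈ S, p r = r ∧ Reaches p w r := by
  induction w using WellFoundedGT.induction with
  | ind w ih =>
    by_cases h : p w = w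
    · exact ⟨w, hw, h, Reaches.refl p w⟩
    · obtain ⟨r, hr, hrr, hr'⟩ := ih (p w) (lt_of_le_of_ne (hp.le w) (Ne.symm h)) (hp.maps w hw)
      exact ⟨r, hr, hrr, (reaches_iff p w r).2 (Or.inr hr')⟩

theorem fixed_of_isMax (hp : IsTreeOn S p) {m : ι} (hm : m ∈ S) (hmax : ∀ i ∈ S, i ≤ m) :
    p m = m :=
  le_antisymm (hmax _ (hp.maps m hm)) (hp.le m)

theorem reaches_isMax (hp : IsTreeOn S p) {m w : ι} (hm : m ∈ S) (hmax : ∀ i ∈ S, i ≤ m)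
    (hw : w ∈ S) : Reaches p w m := by
  obtain ⟨r, hr, hrr, h⟩ := hp.exists_root hw
  rwa [hp.unique m hm r hr (hp.fixed_of_isMax hm hmax) hrr]

theorem card_roots (hp : IsTreeOn S p) :
    (S.filter fun i => p i = i).card = if S = ∅ then 0 else 1 := by
  split_ifs with h
  · simp [h]
  · obtain ⟨w, hw⟩ := Finset.nonempty_iff_ne_empty.2 h
    obtain ⟨r, hr, hrr, -⟩ := hp.exists_root hw
    rw [Finset.card_eq_one]
    refine ⟨r, ?_⟩
    ext i
    simp only [Finset.mem_filter, Finset.mem_singleton]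
    exact ⟨fun hi => hp.unique i hi.1 r hr hi.2 hrr, fun hi => hi ▸ ⟨hr, hrr⟩⟩

end IsTreeOn

/-- The parent map obtained by making the roots of `f` on `U` and `g` on `V` children of `M`. -/
def joinTrees (M : ι) (U V : Finset ι) (f g : ι → ι) (i : ι) : ι :=
  if i ∈ U then (if f i = i then M else f i)
  else if i ∈ V then (if g i = i then M else g i) else i

/-- The parent map `p` with all edges leaving or outside `U` cut. -/
def restrictTree (U : Finset ι) (p : ι → ι) (i : ι) : ι :=
  if i ∈ U ∧ p i ∈ U then p i else i

section Join

variable {M : ι} {U V : Finset ι} {f g : ι → ι}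

theorem joinTrees_comm (hUV : Disjoint U V) :
    joinTrees M U V f g = joinTrees M V U g f := by
  funext i
  have : i ∈ U → i ∉ V := fun h => Finset.disjoint_left.1 hUV h
  unfold joinTrees
  split_ifs <;> tauto

theorem joinTrees_of_notMem {i : ι} (hU : i ∉ U) (hV : i ∉ V) : joinTrees M U V f g i = i := by
  simp [joinTrees, hU, hV]

theorem joinTrees_of_mem_left {i : ι} (hU : i ∈ U) :
    joinTrees M U V f g i = if f i = i then M else f i := by
  simp [joinTrees, hU]

theorem joinTrees_of_mem_right (hUV : Disjoint U V) {i : ι} (hV : i ∈ V) :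
    joinTrees M U V f g i = if g i = i then M else g i := by
  rw [joinTrees_comm hUV, joinTrees_of_mem_left hV]

theorem reaches_joinTrees_left (hf : IsTreeOn U f) (hMU : M ∉ U) (hMV : M ∉ V) {w : ι}
    (hw : w ∈ U) (v : ι) :
    Reaches (joinTrees M U V f g) w v ↔ Reaches f w v ∨ v = M := by
  induction w using WellFoundedGT.induction with
  | ind w ih =>
    rw [reaches_iff, joinTrees_of_mem_left hw]
    split_ifs with h
    · rw [reaches_iff_eq h, reaches_iff_eq (joinTrees_of_notMem hMU hMV), eq_comm (a := M)]
    · rw [ih (f w) (lt_of_le_of_ne (hf.le w) (Ne.symm h)) (hf.maps w hw), reaches_iff f w, or_assoc]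

theorem reaches_joinTrees_right (hUV : Disjoint U V) (hg : IsTreeOn V g) (hMU : M ∉ U)
    (hMV : M ∉ V) {w : ι} (hw : w ∈ V) (v : ι) :
    Reaches (joinTrees M U V f g) w v ↔ Reaches g w v ∨ v = M := by
  rw [joinTrees_comm hUV, reaches_joinTrees_left hg hMV hMU hw]

theorem reaches_joinTrees_of_mem_left (hUV : Disjoint U V) (hf : IsTreeOn U f)
    (hg : IsTreeOn V g) (hMU : M ∉ U) (hMV : M ∉ V) (w : ι) {v : ι} (hv : v ∈ U) :
    Reaches (joinTrees M U V f g) w v ↔ Reaches f w v := by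
  have hvM : v ≠ M := fun h => hMU (h ▸ hv)
  by_cases hwU : w ∈ U
  · simp [reaches_joinTrees_left hf hMU hMV hwU, hvM]
  rw [reaches_iff_eq (hf.fixed w hwU)]
  by_cases hwV : w ∈ V
  · have h1 : w ≠ v := fun h => hwU (h ▸ hv)
    have h2 : ¬ Reaches g w v := fun h =>
      Finset.disjoint_left.1 hUV hv (hg.mem_of_reaches hwV h)
    simp [reaches_joinTrees_right hUV hg hMU hMV hwV, hvM, h1, h2]
  · rw [reaches_iff_eq (joinTrees_of_notMem hwU hwV)]

theorem reaches_joinTrees_of_mem_right (hUV : Disjoint U V) (hf : IsTreeOn U f)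
    (hg : IsTreeOn V g) (hMU : M ∉ U) (hMV : M ∉ V) (w : ι) {v : ι} (hv : v ∈ V) :
    Reaches (joinTrees M U V f g) w v ↔ Reaches g w v := by
  rw [joinTrees_comm hUV, reaches_joinTrees_of_mem_left hUV.symm hg hf hMV hMU w hv]

theorem reaches_joinTrees_root (hUV : Disjoint U V) (hf : IsTreeOn U f)
    (hg : IsTreeOn V g) (hMU : M ∉ U) (hMV : M ∉ V) (w : ι) :
    Reaches (joinTrees M U V f g) w M ↔ w ∈ insert M (U ∪ V) := by
  by_cases hwU : w ∈ U
  · simp [reaches_joinTrees_left hf hMU hMV hwU, hwU]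
  by_cases hwV : w ∈ V
  · simp [reaches_joinTrees_right hUV hg hMU hMV hwV, hwV]
  · simp [reaches_iff_eq (joinTrees_of_notMem hwU hwV), hwU, hwV]

theorem hookOf_joinTrees_left (hUV : Disjoint U V) (hf : IsTreeOn U f)
    (hg : IsTreeOn V g) (hMU : M ∉ U) (hMV : M ∉ V) {v : ι} (hv : v ∈ U) :
    hookOf (joinTrees M U V f g) v = hookOf f v := by
  simp only [hookOf, reaches_joinTrees_of_mem_left hUV hf hg hMU hMV _ hv]

theorem hookOf_joinTrees_right (hUV : Disjoint U V) (hf : IsTreeOn U f)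
    (hg : IsTreeOn V g) (hMU : M ∉ U) (hMV : M ∉ V) {v : ι} (hv : v ∈ V) :
    hookOf (joinTrees M U V f g) v = hookOf g v := by
  simp only [hookOf, reaches_joinTrees_of_mem_right hUV hf hg hMU hMV _ hv]

theorem hookOf_joinTrees_root (hUV : Disjoint U V) (hf : IsTreeOn U f)
    (hg : IsTreeOn V g) (hMU : M ∉ U) (hMV : M ∉ V) :
    hookOf (joinTrees M U V f g) M = (insert M (U ∪ V)).card := by
  simp only [hookOf, reaches_joinTrees_root hUV hf hg hMU hMV]
  congr 1
  ext i
  simp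

theorem childrenOf_joinTrees_left (hUV : Disjoint U V) (hf : IsTreeOn U f)
    (hg : IsTreeOn V g) (hMU : M ∉ U) {j : ι} (hj : j ∈ U) :
    childrenOf (joinTrees M U V f g) j = childrenOf f j := by
  have hjM : M ≠ j := fun h => hMU (h ▸ hj)
  have hjV := Finset.disjoint_left.1 hUV hj
  ext i
  simp only [mem_childrenOf]
  by_cases hiU : i ∈ U
  · rw [joinTrees_of_mem_left hiU]
    split_ifs with h
    · grind
    · rfl
  rw [hf.fixed i hiU]
  by_cases hiV : i ∈ V
  · rw [joinTrees_of_mem_right hUV hiV]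
    have := hg.maps i hiV
    split_ifs with h <;> grind
  · rw [joinTrees_of_notMem hiU hiV]

theorem childrenOf_joinTrees_right (hUV : Disjoint U V) (hf : IsTreeOn U f)
    (hg : IsTreeOn V g) (hMV : M ∉ V) {j : ι} (hj : j ∈ V) :
    childrenOf (joinTrees M U V f g) j = childrenOf g j := by
  rw [joinTrees_comm hUV, childrenOf_joinTrees_left hUV.symm hg hf hMV hj]

theorem childrenOf_joinTrees_root (hUV : Disjoint U V) (hf : IsTreeOn U f)
    (hg : IsTreeOn V g) (hMU : M ∉ U) (hMV : M ∉ V) :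
    childrenOf (joinTrees M U V f g) M
      = (U.filter fun i => f i = i) ∪ (V.filter fun i => g i = i) := by
  ext i
  simp only [mem_childrenOf, Finset.mem_union, Finset.mem_filter]
  by_cases hiU : i ∈ U
  · have := hf.maps i hiU
    have := Finset.disjoint_left.1 hUV hiU
    rw [joinTrees_of_mem_left hiU]
    split_ifs with h <;> grind
  by_cases hiV : i ∈ V
  · have := hg.maps i hiV
    rw [joinTrees_of_mem_right hUV hiV]
    split_ifs with h <;> grind
  · rw [joinTrees_of_notMem hiU hiV]
    grind

theorem card_childrenOf_joinTrees_root (hUV : Disjoint U V) (hf : IsTreeOn U f)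
    (hg : IsTreeOn V g) (hMU : M ∉ U) (hMV : M ∉ V) :
    (childrenOf (joinTrees M U V f g) M).card
      = (if U = ∅ then 0 else 1) + (if V = ∅ then 0 else 1) := by
  rw [childrenOf_joinTrees_root hUV hf hg hMU hMV, Finset.card_union_of_disjoint,
    hf.card_roots, hg.card_roots]
  exact Finset.disjoint_filter_filter hUV

theorem isTreeOn_joinTrees (hUV : Disjoint U V) (hf : IsTreeOn U f) (hg : IsTreeOn V g)
    (hM : ∀ i ∈ U ∪ V, i < M) : IsTreeOn (insert M (U ∪ V)) (joinTrees M U V f g) := by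
  have hMU : M ∉ U := fun h => lt_irrefl M (hM M (Finset.mem_union_left V h))
  have hMV : M ∉ V := fun h => lt_irrefl M (hM M (Finset.mem_union_right U h))
  have key : ∀ i ∈ U ∪ V, i < joinTrees M U V f g i ∧
      joinTrees M U V f g i ∈ insert M (U ∪ V) := by
    intro i hi
    have hiM := hM i hi
    rcases Finset.mem_union.1 hi with hi | hi
    · have := hf.maps i hi
      have := hf.le i
      rw [joinTrees_of_mem_left hi]
      split_ifs with h <;> grind
    · have := hg.maps i hi
      have := hg.le i
      rw [joinTrees_of_mem_right hUV hi]
      split_ifs with h <;> grind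
  have hfix : ∀ i ∉ U ∪ V, joinTrees M U V f g i = i := fun i hi =>
    joinTrees_of_notMem (fun h => hi (Finset.mem_union_left V h))
      (fun h => hi (Finset.mem_union_right U h))
  have hroot : ∀ i ∈ insert M (U ∪ V), joinTrees M U V f g i = i → i = M := by
    intro i hi h
    refine (Finset.mem_insert.1 hi).resolve_right fun hi => ?_
    exact (key i hi).1.ne' h
  refine ⟨fun i hi => hfix i fun h => hi (Finset.mem_insert_of_mem h), fun i hi => ?_, fun i => ?_,
    fun i hi j hj h h' => (hroot i hi h).trans (hroot j hj h').symm, fun j => ?_⟩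
  · by_cases h : i ∈ U ∪ V
    · exact (key i h).2
    · rwa [hfix i h]
  · by_cases h : i ∈ U ∪ V
    · exact (key i h).1.le
    · rw [hfix i h]
  · by_cases hj : j ∈ insert M (U ∪ V)
    · rw [Finset.mem_insert, Finset.mem_union] at hj
      rcases hj with rfl | hj | hj
      · rw [card_childrenOf_joinTrees_root hUV hf hg hMU hMV]
        split_ifs <;> simp
      · rw [childrenOf_joinTrees_left hUV hf hg hMU hj]
        exact hf.card_le j
      · rw [childrenOf_joinTrees_right hUV hf hg hMV hj]
        exact hg.card_le j
    · suffices childrenOf (joinTrees M U V f g) j = ∅ by simp [this]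
      ext i
      rw [mem_childrenOf]
      by_cases hi : i ∈ U ∪ V
      · have := (key i hi).2
        grind
      · rw [hfix i hi]
        grind

theorem restrictTree_joinTrees_left (hf : IsTreeOn U f) (hMU : M ∉ U) :
    restrictTree U (joinTrees M U V f g) = f := by
  funext i
  unfold restrictTree
  by_cases hi : i ∈ U
  · have := hf.maps i hi
    rw [joinTrees_of_mem_left hi]
    split_ifs with h h' <;> grind
  · rw [hf.fixed i hi]
    simp [hi]

theorem restrictTree_joinTrees_right (hUV : Disjoint U V) (hg : IsTreeOn V g) (hMV : M ∉ V) :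
    restrictTree V (joinTrees M U V f g) = g := by
  rw [joinTrees_comm hUV, restrictTree_joinTrees_left hg hMV]

end Join

section Cut

variable {M m : ι} {T : Finset ι} {p : ι → ι}

theorem isTreeOn_restrictTree {S U : Finset ι} (hp : IsTreeOn S p)
    (h : ∀ i ∈ U, ∀ j ∈ U, (p i ∉ U ∨ p i = i) → (p j ∉ U ∨ p j = j) → i = j) :
    IsTreeOn U (restrictTree U p) := by
  refine ⟨fun i hi => by simp [restrictTree, hi], fun i hi => ?_, fun i => ?_,
    fun i hi j hj hi' hj' => ?_, fun j => ?_⟩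
  · unfold restrictTree
    split_ifs with h
    · exact h.2
    · exact hi
  · unfold restrictTree
    split_ifs with h
    · exact hp.le i
    · exact le_rfl
  · refine h i hi j hj ?_ ?_
    · unfold restrictTree at hi'
      grind
    · unfold restrictTree at hj'
      grind
  · refine (Finset.card_le_card fun i hi => ?_).trans (hp.card_le j)
    rw [mem_childrenOf] at hi ⊢
    unfold restrictTree at hi
    grind

/-- The vertices of the subtree rooted at `m`. -/
noncomputable def descendants (p : ι → ι) (m : ι) : Finset ι :=
  Finset.univ.filter fun w => Reaches p w m

theorem mem_descendants {w : ι} : w ∈ descendants p m ↔ Reaches p w m := by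
  simp [descendants]

theorem parent_isMax (hp : IsTreeOn (insert M T) p) (hM : ∀ i ∈ T, i < M) (hm : m ∈ T)
    (hmax : ∀ i ∈ T, i ≤ m) : p m = M := by
  have hMT : ∀ i ∈ insert M T, i ≤ M := by
    intro i hi
    rcases Finset.mem_insert.1 hi with rfl | hi
    · exact le_rfl
    · exact (hM i hi).le
  have hMM := hp.fixed_of_isMax (Finset.mem_insert_self M T) hMT
  refine (Finset.mem_insert.1 (hp.maps m (Finset.mem_insert_of_mem hm))).resolve_right fun h => ?_
  have hmm : p m = m := le_antisymm (hmax _ h) (hp.le m)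
  have := hp.unique m (Finset.mem_insert_of_mem hm) M (Finset.mem_insert_self M T) hmm hMM
  exact (hM m hm).ne this

theorem root_fixed (hp : IsTreeOn (insert M T) p) (hM : ∀ i ∈ T, i < M) : p M = M := by
  refine hp.fixed_of_isMax (Finset.mem_insert_self M T) fun i hi => ?_
  rcases Finset.mem_insert.1 hi with rfl | hi
  · exact le_rfl
  · exact (hM i hi).le

theorem descendants_subset (hp : IsTreeOn (insert M T) p) (hM : ∀ i ∈ T, i < M) (hm : m ∈ T) :
    descendants p m ⊆ T := by
  intro w hw
  rw [mem_descendants] at hw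
  have := hp.mem_of_reaches_mem (Finset.mem_insert_of_mem hm) hw
  refine (Finset.mem_insert.1 this).resolve_left ?_
  rintro rfl
  rw [reaches_iff_eq (root_fixed hp hM)] at hw
  exact (hM m hm).ne hw.symm

theorem parent_mem_descendants {i : ι} (hi : i ∈ descendants p m) (him : i ≠ m) :
    p i ∈ descendants p m := by
  rw [mem_descendants] at hi ⊢
  exact ((reaches_iff p i m).1 hi).resolve_left him

theorem mem_descendants_of_parent {i : ι} (hi : p i ∈ descendants p m) :
    i ∈ descendants p m := by
  rw [mem_descendants] at hi ⊢
  exact (reaches_iff p i m).2 (Or.inr hi)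

theorem ne_fixed (hp : IsTreeOn (insert M T) p) (hM : ∀ i ∈ T, i < M) {i : ι} (hi : i ∈ T) :
    p i ≠ i := fun h =>
  (hM i hi).ne (hp.unique i (Finset.mem_insert_of_mem hi) M (Finset.mem_insert_self M T) h
    (root_fixed hp hM))

theorem isTreeOn_restrictTree_descendants (hp : IsTreeOn (insert M T) p) (hM : ∀ i ∈ T, i < M)
    (hm : m ∈ T) : IsTreeOn (descendants p m) (restrictTree (descendants p m) p) := by
  have key : ∀ i ∈ descendants p m, (p i ∉ descendants p m ∨ p i = i) → i = m := by
    intro i hi h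
    by_contra him
    rcases h with h | h
    · exact h (parent_mem_descendants hi him)
    · exact ne_fixed hp hM (descendants_subset hp hM hm hi) h
  exact isTreeOn_restrictTree hp fun i hi j hj hi' hj' => (key i hi hi').trans (key j hj hj').symm

theorem isTreeOn_restrictTree_sdiff (hp : IsTreeOn (insert M T) p) (hM : ∀ i ∈ T, i < M)
    (hm : m ∈ T) (hmax : ∀ i ∈ T, i ≤ m) :
    IsTreeOn (T \ descendants p m) (restrictTree (T \ descendants p m) p) := by
  have key : ∀ i ∈ T \ descendants p m, (p i ∉ T \ descendants p m ∨ p i = i) → p i = M := by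
    intro i hi h
    rw [Finset.mem_sdiff] at hi
    have h := h.resolve_right (ne_fixed hp hM hi.1)
    refine (Finset.mem_insert.1 (hp.maps i (Finset.mem_insert_of_mem hi.1))).resolve_right
      fun h' => h (Finset.mem_sdiff.2 ⟨h', fun h'' => hi.2 (mem_descendants_of_parent h'')⟩)
  refine isTreeOn_restrictTree hp fun i hi j hj hi' hj' => ?_
  by_contra hij
  have hiM := key i hi hi'
  have hjM := key j hj hj'
  rw [Finset.mem_sdiff] at hi hj
  have hmd : m ∈ descendants p m := mem_descendants.2 (Reaches.refl p m)
  have hcard : ({m, i, j} : Finset ι).card = 3 := by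
    rw [Finset.card_eq_three]
    exact ⟨m, i, j, fun h => hi.2 (h ▸ hmd), fun h => hj.2 (h ▸ hmd), hij, rfl⟩
  have hsub : ({m, i, j} : Finset ι) ⊆ childrenOf p M := by
    intro k hk
    simp only [Finset.mem_insert, Finset.mem_singleton] at hk
    rw [mem_childrenOf]
    rcases hk with rfl | rfl | rfl
    · exact ⟨parent_isMax hp hM hm hmax, (hM _ hm).ne⟩
    · exact ⟨hiM, (hM _ hi.1).ne⟩
    · exact ⟨hjM, (hM _ hj.1).ne⟩
  have := (Finset.card_le_card hsub).trans (hp.card_le M)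
  omega

theorem joinTrees_restrictTree (hp : IsTreeOn (insert M T) p) (hM : ∀ i ∈ T, i < M)
    (hm : m ∈ T) (hmax : ∀ i ∈ T, i ≤ m) :
    joinTrees M (descendants p m) (T \ descendants p m) (restrictTree (descendants p m) p)
      (restrictTree (T \ descendants p m) p) = p := by
  have hMT : M ∉ T := fun h => lt_irrefl M (hM M h)
  have hsub := descendants_subset hp hM hm
  have hdisj : Disjoint (descendants p m) (T \ descendants p m) := Finset.disjoint_sdiff
  funext i
  by_cases hiT : i ∈ T
  · have hi := hp.maps i (Finset.mem_insert_of_mem hiT)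
    have hii := ne_fixed hp hM hiT
    by_cases hiU : i ∈ descendants p m
    · rw [joinTrees_of_mem_left hiU]
      by_cases him : i = m
      · subst him
        have hpM := parent_isMax hp hM hm hmax
        have : M ∉ descendants p i := fun h => hMT (hsub h)
        simp [restrictTree, hpM, this]
      · have := parent_mem_descendants hiU him
        simp [restrictTree, hiU, this, hii]
    · have hiV : i ∈ T \ descendants p m := Finset.mem_sdiff.2 ⟨hiT, hiU⟩
      have hpU : p i ∉ descendants p m := fun h => hiU (mem_descendants_of_parent h)
      rw [joinTrees_of_mem_right hdisj hiV]
      by_cases hpM : p i = M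
      · simp [restrictTree, hpM, hMT]
      · have hpT : p i ∈ T := (Finset.mem_insert.1 hi).resolve_left hpM
        simp [restrictTree, hiU, hiT, hpU, hpT, hii]
  · rw [joinTrees_of_notMem (fun h => hiT (hsub h)) (fun h => hiT (Finset.mem_sdiff.1 h).1)]
    by_cases hiM : i = M
    · rw [hiM, root_fixed hp hM]
    · exact (hp.fixed i (by simp [hiM, hiT])).symm

theorem descendants_joinTrees {U : Finset ι} {f g : ι → ι} (hf : IsTreeOn U f)
    (hg : IsTreeOn (T \ U) g) (hUT : U ⊆ T) (hM : ∀ i ∈ T, i < M) (hm : m ∈ U)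
    (hmax : ∀ i ∈ T, i ≤ m) : descendants (joinTrees M U (T \ U) f g) m = U := by
  have hMT : M ∉ T := fun h => lt_irrefl M (hM M h)
  ext w
  rw [mem_descendants, reaches_joinTrees_of_mem_left Finset.disjoint_sdiff hf hg
    (fun h => hMT (hUT h)) (fun h => hMT (Finset.mem_sdiff.1 h).1) w hm]
  exact ⟨hf.mem_of_reaches_mem hm, hf.reaches_isMax hm fun i hi => hmax i (hUT hi)⟩

theorem sum_treesOn_insert (hM : ∀ i ∈ T, i < M) (hm : m ∈ T) (hmax : ∀ i ∈ T, i ≤ m)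
    (F : (ι → ι) → ℚ) :
    ∑ p ∈ treesOn (insert M T), F p
      = ∑ U ∈ T.powerset.filter (m ∈ ·), ∑ f ∈ treesOn U, ∑ g ∈ treesOn (T \ U),
          F (joinTrees M U (T \ U) f g) := by
  have hMT : M ∉ T := fun h => lt_irrefl M (hM M h)
  rw [← Finset.sum_fiberwise_of_maps_to (g := fun p => descendants p m)
    (t := T.powerset.filter (m ∈ ·))]
  · refine Finset.sum_congr rfl fun U hU => ?_
    rw [Finset.mem_filter, Finset.mem_powerset] at hU
    obtain ⟨hUT, hmU⟩ := hU
    rw [← Finset.sum_product']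
    refine Finset.sum_bij' (fun p _ => (restrictTree U p, restrictTree (T \ U) p))
      (fun x _ => joinTrees M U (T \ U) x.1 x.2) ?_ ?_ ?_ ?_ ?_
    · intro p hp
      rw [Finset.mem_filter, mem_treesOn] at hp
      obtain ⟨hp, rfl⟩ := hp
      rw [Finset.mem_product, mem_treesOn, mem_treesOn]
      exact ⟨isTreeOn_restrictTree_descendants hp hM hm,
        isTreeOn_restrictTree_sdiff hp hM hm hmax⟩
    · intro x hx
      rw [Finset.mem_product, mem_treesOn, mem_treesOn] at hx
      rw [Finset.mem_filter, mem_treesOn]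
      refine ⟨?_, descendants_joinTrees hx.1 hx.2 hUT hM hmU hmax⟩
      have := isTreeOn_joinTrees Finset.disjoint_sdiff hx.1 hx.2 (M := M)
        (by rwa [Finset.union_sdiff_of_subset hUT])
      rwa [Finset.union_sdiff_of_subset hUT] at this
    · intro p hp
      rw [Finset.mem_filter, mem_treesOn] at hp
      obtain ⟨hp, rfl⟩ := hp
      exact joinTrees_restrictTree hp hM hm hmax
    · intro x hx
      rw [Finset.mem_product, mem_treesOn, mem_treesOn] at hx
      exact Prod.ext (restrictTree_joinTrees_left hx.1 fun h => hMT (hUT h))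
        (restrictTree_joinTrees_right Finset.disjoint_sdiff hx.2
          fun h => hMT (Finset.mem_sdiff.1 h).1)
    · intro p hp
      rw [Finset.mem_filter, mem_treesOn] at hp
      obtain ⟨hp, rfl⟩ := hp
      exact congrArg F (joinTrees_restrictTree hp hM hm hmax).symm
  · intro p hp
    rw [mem_treesOn] at hp
    rw [Finset.mem_filter, Finset.mem_powerset]
    exact ⟨descendants_subset hp hM hm, mem_descendants.2 (Reaches.refl p m)⟩

end Cut

/-! ### Weighted enumeration -/

/-- The weight of a vertex of hook length `h` off the distinguished path. -/
def offPathWeight (q : ℚ) (h : ℕ) : ℚ :=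
  if 1 < h then 2 + q * ((h : ℚ) - 1) else 1

/-- The weight of a vertex of hook length `h` on the distinguished path. -/
def onPathWeight (q : ℚ) (h : ℕ) : ℚ :=
  1 + q * ((h : ℚ) - 1)

/-- The weight of an unpointed tree on `S`. -/
noncomputable def treeWeight (q : ℚ) (S : Finset ι) (p : ι → ι) : ℚ :=
  ∏ v ∈ S, offPathWeight q (hookOf p v)

/-- The weight of the tree `p` on `S` with distinguished vertex `u`. -/
noncomputable def pointedWeight (q : ℚ) (S : Finset ι) (p : ι → ι) (u : ι) : ℚ :=
  ∏ v ∈ S, if Reaches p u v then onPathWeight q (hookOf p v) else offPathWeight q (hookOf p v)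

/-- The sum of `pointedWeight` over the possible distinguished vertices of `p`. -/
noncomputable def totalPointedWeight (q : ℚ) (S : Finset ι) (p : ι → ι) : ℚ :=
  ∑ u ∈ S, if (childrenOf p u).card ≤ 1 then pointedWeight q S p u else 0

section JoinWeight

variable {M : ι} {U V : Finset ι} {f g : ι → ι} (q : ℚ)

theorem treeWeight_joinTrees (hUV : Disjoint U V) (hf : IsTreeOn U f) (hg : IsTreeOn V g)
    (hMU : M ∉ U) (hMV : M ∉ V) :
    treeWeight q (insert M (U ∪ V)) (joinTrees M U V f g)
      = offPathWeight q (insert M (U ∪ V)).card * (treeWeight q U f * treeWeight q V g) := by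
  have hMUV : M ∉ U ∪ V := by simp [hMU, hMV]
  unfold treeWeight
  rw [Finset.prod_insert hMUV, Finset.prod_union hUV, hookOf_joinTrees_root hUV hf hg hMU hMV]
  congr 2
  · exact Finset.prod_congr rfl fun v hv => by rw [hookOf_joinTrees_left hUV hf hg hMU hMV hv]
  · exact Finset.prod_congr rfl fun v hv => by rw [hookOf_joinTrees_right hUV hf hg hMU hMV hv]

theorem pointedWeight_joinTrees (hUV : Disjoint U V) (hf : IsTreeOn U f) (hg : IsTreeOn V g)
    (hMU : M ∉ U) (hMV : M ∉ V) {u : ι} (hu : u ∈ insert M (U ∪ V)) :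
    pointedWeight q (insert M (U ∪ V)) (joinTrees M U V f g) u
      = onPathWeight q (insert M (U ∪ V)).card *
          (pointedWeight q U f u * pointedWeight q V g u) := by
  have hMUV : M ∉ U ∪ V := by simp [hMU, hMV]
  unfold pointedWeight
  rw [Finset.prod_insert hMUV, Finset.prod_union hUV, hookOf_joinTrees_root hUV hf hg hMU hMV,
    if_pos ((reaches_joinTrees_root hUV hf hg hMU hMV u).2 hu)]
  congr 2
  · exact Finset.prod_congr rfl fun v hv => by
      rw [hookOf_joinTrees_left hUV hf hg hMU hMV hv]
      simp only [reaches_joinTrees_of_mem_left hUV hf hg hMU hMV u hv]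
  · exact Finset.prod_congr rfl fun v hv => by
      rw [hookOf_joinTrees_right hUV hf hg hMU hMV hv]
      simp only [reaches_joinTrees_of_mem_right hUV hf hg hMU hMV u hv]

theorem pointedWeight_of_notMem (hf : IsTreeOn U f) {u : ι} (hu : u ∉ U) :
    pointedWeight q U f u = treeWeight q U f :=
  Finset.prod_congr rfl fun _ hv => if_neg fun h => hu (hf.mem_of_reaches_mem hv h)

theorem totalPointedWeight_joinTrees (hUV : Disjoint U V) (hf : IsTreeOn U f)
    (hg : IsTreeOn V g) (hMU : M ∉ U) (hMV : M ∉ V) (hU : U ≠ ∅) :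
    totalPointedWeight q (insert M (U ∪ V)) (joinTrees M U V f g)
      = onPathWeight q (insert M (U ∪ V)).card *
          (totalPointedWeight q U f * treeWeight q V g
            + treeWeight q U f * (totalPointedWeight q V g + if V = ∅ then 1 else 0)) := by
  have hMUV : M ∉ U ∪ V := by simp [hMU, hMV]
  rw [totalPointedWeight, Finset.sum_insert hMUV, Finset.sum_union hUV,
    card_childrenOf_joinTrees_root hUV hf hg hMU hMV,
    pointedWeight_joinTrees q hUV hf hg hMU hMV (Finset.mem_insert_self _ _),
    pointedWeight_of_notMem q hf hMU, pointedWeight_of_notMem q hg hMV]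
  have h1 : ∑ u ∈ U, (if (childrenOf (joinTrees M U V f g) u).card ≤ 1 then
      pointedWeight q (insert M (U ∪ V)) (joinTrees M U V f g) u else 0)
      = onPathWeight q (insert M (U ∪ V)).card *
        (totalPointedWeight q U f * treeWeight q V g) := by
    rw [totalPointedWeight, Finset.sum_mul, Finset.mul_sum]
    refine Finset.sum_congr rfl fun u hu => ?_
    rw [childrenOf_joinTrees_left hUV hf hg hMU hu,
      pointedWeight_joinTrees q hUV hf hg hMU hMV (by simp [hu]),
      pointedWeight_of_notMem q hg (Finset.disjoint_left.1 hUV hu)]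
    split_ifs <;> ring
  have h2 : ∑ u ∈ V, (if (childrenOf (joinTrees M U V f g) u).card ≤ 1 then
      pointedWeight q (insert M (U ∪ V)) (joinTrees M U V f g) u else 0)
      = onPathWeight q (insert M (U ∪ V)).card *
        (treeWeight q U f * totalPointedWeight q V g) := by
    rw [totalPointedWeight, Finset.mul_sum, Finset.mul_sum]
    refine Finset.sum_congr rfl fun u hu => ?_
    rw [childrenOf_joinTrees_right hUV hf hg hMV hu,
      pointedWeight_joinTrees q hUV hf hg hMU hMV (by simp [hu]),
      pointedWeight_of_notMem q hf (Finset.disjoint_right.1 hUV hu)]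
    split_ifs <;> ring
  rw [h1, h2]
  by_cases hV : V = ∅
  · subst hV
    simp [hU, treeWeight]
    ring
  · simp [hU, hV]
    ring

end JoinWeight

/-- The generating function of trees on `S`. -/
noncomputable def treeSum (q : ℚ) (S : Finset ι) : ℚ :=
  ∑ p ∈ treesOn S, treeWeight q S p

/-- The generating function of pointed trees on `S`, the empty tree counting as pointed. -/
noncomputable def pointedSum (q : ℚ) (S : Finset ι) : ℚ :=
  ∑ p ∈ treesOn S, (totalPointedWeight q S p + if S = ∅ then 1 else 0)

theorem childrenOf_id (j : ι) : childrenOf id j = ∅ := by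
  ext i
  rw [mem_childrenOf]
  simp

theorem hookOf_id (v : ι) : hookOf id v = 1 := by
  rw [hookOf, Finset.card_eq_one]
  refine ⟨v, ?_⟩
  ext w
  simp [reaches_iff_eq (p := id) (w := w) rfl]

theorem treesOn_eq_singleton_id {S : Finset ι} (hS : S.card ≤ 1) : treesOn S = {id} := by
  rw [Finset.card_le_one] at hS
  ext p
  rw [mem_treesOn, Finset.mem_singleton]
  constructor
  · intro hp
    funext i
    by_cases hi : i ∈ S
    · exact hS _ (hp.maps i hi) _ hi
    · exact hp.fixed i hi
  · rintro rfl
    exact ⟨fun _ _ => rfl, fun _ h => h, fun _ => le_rfl, fun i hi j hj _ _ => hS i hi j hj,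
      fun j => by simp [childrenOf_id]⟩

theorem treeSum_of_card_le_one (q : ℚ) {S : Finset ι} (hS : S.card ≤ 1) : treeSum q S = 1 := by
  simp [treeSum, treesOn_eq_singleton_id hS, treeWeight, hookOf_id, offPathWeight]

theorem pointedSum_of_card_le_one (q : ℚ) {S : Finset ι} (hS : S.card ≤ 1) :
    pointedSum q S = 1 := by
  simp only [pointedSum, treesOn_eq_singleton_id hS, totalPointedWeight, pointedWeight, hookOf_id,
    offPathWeight, onPathWeight, childrenOf_id, Finset.sum_singleton]
  rcases S.eq_empty_or_nonempty with rfl | h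
  · simp
  · simp [Finset.nonempty_iff_ne_empty.1 h, le_antisymm hS h.card_pos]

section Recursion

variable {M m : ι} {T : Finset ι} (q : ℚ)

theorem treeSum_insert (hM : ∀ i ∈ T, i < M) (hm : m ∈ T) (hmax : ∀ i ∈ T, i ≤ m) :
    treeSum q (insert M T) = (2 + q * T.card) *
      ∑ U ∈ T.powerset.filter (m ∈ ·), treeSum q U * treeSum q (T \ U) := by
  have hMT : M ∉ T := fun h => lt_irrefl M (hM M h)
  rw [treeSum, sum_treesOn_insert hM hm hmax, Finset.mul_sum]
  refine Finset.sum_congr rfl fun U hU => ?_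
  rw [Finset.mem_filter, Finset.mem_powerset] at hU
  rw [treeSum, treeSum, Finset.sum_mul_sum, Finset.mul_sum]
  refine Finset.sum_congr rfl fun f hf => ?_
  rw [Finset.mul_sum]
  refine Finset.sum_congr rfl fun g hg => ?_
  have h := treeWeight_joinTrees q Finset.disjoint_sdiff (mem_treesOn.1 hf) (mem_treesOn.1 hg)
    (fun h => hMT (hU.1 h)) (fun h => hMT (Finset.mem_sdiff.1 h).1)
  rw [Finset.union_sdiff_of_subset hU.1] at h
  have hT : 0 < T.card := Finset.card_pos.2 ⟨m, hm⟩
  rw [h, Finset.card_insert_of_notMem hMT, offPathWeight, if_pos (by omega)]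
  push_cast
  ring

theorem pointedSum_insert (hM : ∀ i ∈ T, i < M) (hm : m ∈ T) (hmax : ∀ i ∈ T, i ≤ m) :
    pointedSum q (insert M T) = (1 + q * T.card) *
      ∑ U ∈ T.powerset.filter (m ∈ ·),
        (pointedSum q U * treeSum q (T \ U) + treeSum q U * pointedSum q (T \ U)) := by
  have hMT : M ∉ T := fun h => lt_irrefl M (hM M h)
  rw [pointedSum, sum_treesOn_insert hM hm hmax, Finset.mul_sum]
  refine Finset.sum_congr rfl fun U hU => ?_
  rw [Finset.mem_filter, Finset.mem_powerset] at hU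
  rw [treeSum, treeSum, pointedSum, pointedSum, Finset.sum_mul_sum, Finset.sum_mul_sum,
    ← Finset.sum_add_distrib, Finset.mul_sum]
  refine Finset.sum_congr rfl fun f hf => ?_
  rw [← Finset.sum_add_distrib, Finset.mul_sum]
  refine Finset.sum_congr rfl fun g hg => ?_
  have hU0 : U ≠ ∅ := Finset.ne_empty_of_mem hU.2
  have h := totalPointedWeight_joinTrees q Finset.disjoint_sdiff (mem_treesOn.1 hf)
    (mem_treesOn.1 hg) (fun h => hMT (hU.1 h)) (fun h => hMT (Finset.mem_sdiff.1 h).1) hU0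
  rw [Finset.union_sdiff_of_subset hU.1] at h
  rw [h, Finset.card_insert_of_notMem hMT, onPathWeight, if_neg (Finset.insert_ne_empty M T),
    if_neg hU0]
  push_cast
  ring

end Recursion

theorem sum_powerset_filter_symm {T : Finset ι} {m : ι} (hm : m ∈ T) (a b : ℕ → ℚ) :
    ∑ U ∈ T.powerset.filter (m ∈ ·), (a U.card * b (T \ U).card + b U.card * a (T \ U).card)
      = ∑ k ∈ Finset.HasAntidiagonal.antidiagonal T.card,
          (T.card.choose k.1 : ℚ) * (a k.1 * b k.2) := by
  have h : ∑ U ∈ T.powerset.filter (m ∈ ·), b U.card * a (T \ U).card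
      = ∑ U ∈ T.powerset.filter (m ∉ ·), a U.card * b (T \ U).card := by
    refine Finset.sum_bij' (fun U _ => T \ U) (fun U _ => T \ U) ?_ ?_ ?_ ?_ ?_
    all_goals
      intro U hU
      rw [Finset.mem_filter, Finset.mem_powerset] at hU
    · rw [Finset.mem_filter, Finset.mem_powerset]
      exact ⟨Finset.sdiff_subset, fun h => (Finset.mem_sdiff.1 h).2 hU.2⟩
    · rw [Finset.mem_filter, Finset.mem_powerset]
      exact ⟨Finset.sdiff_subset, Finset.mem_sdiff.2 ⟨hm, hU.2⟩⟩
    · exact Finset.sdiff_sdiff_eq_self hU.1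
    · exact Finset.sdiff_sdiff_eq_self hU.1
    · rw [Finset.sdiff_sdiff_eq_self hU.1, mul_comm]
  rw [Finset.sum_add_distrib, h, Finset.sum_filter_add_sum_filter_not,
    Finset.Nat.sum_antidiagonal_eq_sum_range_succ_mk]
  simp only [← nsmul_eq_mul]
  rw [← Finset.sum_powerset_apply_card (fun k => a k * b (T.card - k))]
  refine Finset.sum_congr rfl fun U hU => ?_
  rw [Finset.card_sdiff_of_subset (Finset.mem_powerset.1 hU)]

theorem treeSum_and_pointedSum (q : ℚ) (S : Finset ι) :
    treeSum q S = rothePoly q S.card 1 ∧ pointedSum q S = rotheProd q S.card 0 := by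
  induction S using Finset.strongInduction with
  | H S ih =>
    by_cases hS : S.card ≤ 1
    · rw [treeSum_of_card_le_one q hS, pointedSum_of_card_le_one q hS]
      interval_cases S.card <;> simp [rothePoly, rotheProd]
    have hS0 : S.Nonempty := Finset.card_pos.1 (by omega)
    set M := S.max' hS0
    have hMS : M ∈ S := S.max'_mem hS0
    set T := S.erase M
    have hST : insert M T = S := Finset.insert_erase hMS
    have hMT : M ∉ T := Finset.notMem_erase M S
    have hM : ∀ i ∈ T, i < M := fun i hi => S.lt_max'_of_mem_erase_max' hS0 hi
    have hcard : S.card = T.card + 1 := by rw [← hST, Finset.card_insert_of_notMem hMT]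
    have hT0 : T.Nonempty := Finset.card_pos.1 (by omega)
    have hm := T.max'_mem hT0
    have hmax : ∀ i ∈ T, i ≤ T.max' hT0 := fun i hi => T.le_max' i hi
    have hssub : ∀ U ⊆ T, U ⊂ S := fun U hU =>
      lt_of_le_of_lt hU (Finset.erase_ssubset hMS)
    rw [hcard, ← hST]
    constructor
    · rw [treeSum_insert q hM hm hmax]
      have h : 2 * ∑ U ∈ T.powerset.filter (T.max' hT0 ∈ ·), treeSum q U * treeSum q (T \ U)
          = rothePoly q T.card 2 := by
        rw [show (2 : ℚ) = 1 + 1 by norm_num, ← rothePoly_convolution,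
          ← sum_powerset_filter_symm hm (rothePoly q · 1) (rothePoly q · 1), Finset.mul_sum]
        refine Finset.sum_congr rfl fun U hU => ?_
        rw [Finset.mem_filter, Finset.mem_powerset] at hU
        rw [(ih U (hssub U hU.1)).1, (ih (T \ U) (hssub _ Finset.sdiff_subset)).1]
        ring
      have h2 := two_mul_rothePoly_one_succ q T.card hT0.card_ne_zero
      rw [← h] at h2
      linear_combination -h2 / 2
    · rw [pointedSum_insert q hM hm hmax, rotheProd_zero_succ, ← zero_add (1 : ℚ),
        ← rotheProd_convolution,
        ← sum_powerset_filter_symm hm (rotheProd q · 0) (rothePoly q · 1), zero_add]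
      congr 1
      refine Finset.sum_congr rfl fun U hU => ?_
      rw [Finset.mem_filter, Finset.mem_powerset] at hU
      rw [(ih U (hssub U hU.1)).1, (ih (T \ U) (hssub _ Finset.sdiff_subset)).1,
        (ih U (hssub U hU.1)).2, (ih (T \ U) (hssub _ Finset.sdiff_subset)).2]

end Trees

/-! ### Trees on `Fin n` -/

theorem exists_lt_iterate_iff_reaches {n : ℕ} {p : Fin n → Fin n} (hp : ∀ i, i ≤ p i)
    (w v : Fin n) : (∃ k < n, p^[k] w = v) ↔ Reaches p w v := by
  refine ⟨fun ⟨k, _, h⟩ => ⟨k, h⟩, ?_⟩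
  rintro ⟨k, rfl⟩
  suffices ∃ l, (w : ℕ) + l ≤ p^[k] w ∧ p^[l] w = p^[k] w by
    obtain ⟨l, hl, h⟩ := this
    exact ⟨l, by omega, h⟩
  induction k with
  | zero => exact ⟨0, by simp⟩
  | succ k ih =>
    obtain ⟨l, hl, h⟩ := ih
    rw [Function.iterate_succ_apply']
    rcases (hp (p^[k] w)).eq_or_lt with h' | h'
    · exact ⟨l, by rw [← h']; exact hl, by rw [← h']; exact h⟩
    · refine ⟨l + 1, ?_, by rw [Function.iterate_succ_apply', h]⟩
      have : (p^[k] w : ℕ) < p (p^[k] w) := h'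
      omega

section FinTrees

variable {n : ℕ} {p : Fin n → Fin n}

theorem childCount_filter_eq (h1 : ∀ i : Fin n, (i : ℕ) + 1 < n → (i : ℕ) < (p i : ℕ))
    (h2 : ∀ i : Fin n, ¬ (i : ℕ) + 1 < n → p i = i) (j : Fin n) :
    (Finset.univ.filter fun i : Fin n => (i : ℕ) + 1 < n ∧ p i = j) = childrenOf p j := by
  ext i
  simp only [Finset.mem_filter, Finset.mem_univ, true_and, mem_childrenOf]
  constructor
  · rintro ⟨h, rfl⟩
    refine ⟨rfl, fun h' => ?_⟩
    have := h1 i h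
    rw [← h'] at this
    omega
  · rintro ⟨rfl, h'⟩
    refine ⟨?_, rfl⟩
    by_contra h
    exact h' (h2 i h).symm

theorem isAndreTree_iff : IsAndreTree n p ↔ IsTreeOn Finset.univ p := by
  constructor
  · rintro ⟨h1, h2, h3⟩
    have hroot : ∀ i, p i = i → (i : ℕ) + 1 = n := by
      intro i h
      by_contra h'
      have := h1 i (by omega)
      rw [h] at this
      omega
    refine ⟨by simp, by simp, fun i => ?_, fun i _ j _ hi hj => ?_, fun j => ?_⟩
    · by_cases h : (i : ℕ) + 1 < n
      · exact (h1 i h).le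
      · exact (h2 i h).ge
    · have := hroot i hi
      have := hroot j hj
      omega
    · rw [← childCount_filter_eq h1 h2]
      exact h3 j
  · intro hp
    have h2 : ∀ i : Fin n, ¬ (i : ℕ) + 1 < n → p i = i := by
      intro i hi
      have : (i : ℕ) ≤ p i := hp.le i
      omega
    have h1 : ∀ i : Fin n, (i : ℕ) + 1 < n → (i : ℕ) < (p i : ℕ) := by
      intro i hi
      have hr := hp.unique i (Finset.mem_univ _) ⟨n - 1, by omega⟩ (Finset.mem_univ _)
      refine lt_of_le_of_ne (hp.le i) fun h => ?_
      have := hr (Fin.ext h.symm) (h2 _ (by simp; omega))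
      rw [this] at hi
      simp at hi
      omega
    refine ⟨h1, h2, fun j => ?_⟩
    rw [childCount_filter_eq h1 h2]
    exact hp.card_le j

theorem hookA_eq_hookOf (hp : IsTreeOn Finset.univ p) (v : Fin n) :
    hookA n p v = hookOf p v := by
  simp only [hookA, hookOf, exists_lt_iterate_iff_reaches hp.le]

theorem childCount_eq (hp : IsTreeOn Finset.univ p) (v : Fin n) :
    childCount n p v = (childrenOf p v).card := by
  have h := isAndreTree_iff.2 hp
  rw [childCount, childCount_filter_eq h.1 h.2.1]

theorem hookOf_pos (p : Fin n → Fin n) (v : Fin n) : 0 < hookOf p v :=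
  Finset.card_pos.2 ⟨v, by simp [Reaches.refl]⟩

theorem prod_internalsA_eq (hp : IsTreeOn Finset.univ p) (q : ℚ) (u : Fin n) :
    ∏ v ∈ internalsA n p, (if OnPath n p u v then 1 + q * ((hookA n p v : ℚ) - 1)
        else 2 + q * ((hookA n p v : ℚ) - 1))
      = pointedWeight q Finset.univ p u := by
  rw [internalsA, Finset.prod_filter, pointedWeight]
  refine Finset.prod_congr rfl fun v _ => ?_
  rw [hookA_eq_hookOf hp, OnPath]
  simp only [exists_lt_iterate_iff_reaches hp.le]
  by_cases h : 1 < hookOf p v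
  · simp only [if_pos h, onPathWeight, offPathWeight]
  · have h1 : hookOf p v = 1 := by have := hookOf_pos p v; omega
    simp [h1, onPathWeight, offPathWeight]

theorem sum_pointedAndreTrees_eq (hn : 1 ≤ n) (q : ℚ) :
    ∑ x ∈ pointedAndreTrees n, ∏ v ∈ internalsA n x.1,
        (if OnPath n x.1 x.2 v then 1 + q * ((hookA n x.1 v : ℚ) - 1)
         else 2 + q * ((hookA n x.1 v : ℚ) - 1))
      = pointedSum q (Finset.univ : Finset (Fin n)) := by
  have hne : (Finset.univ : Finset (Fin n)) ≠ ∅ :=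
    Finset.ne_empty_of_mem (Finset.mem_univ ⟨0, hn⟩)
  have htrees : andreTrees n = treesOn Finset.univ := by
    ext p
    rw [mem_treesOn, ← isAndreTree_iff]
    simp [andreTrees]
  rw [pointedAndreTrees, Finset.sum_filter, Finset.sum_product, htrees, pointedSum]
  refine Finset.sum_congr rfl fun p hp => ?_
  rw [mem_treesOn] at hp
  rw [if_neg hne, add_zero, totalPointedWeight]
  refine Finset.sum_congr rfl fun u _ => ?_
  simp only [childCount_eq hp, prod_internalsA_eq hp]

end FinTrees

/-- `∏_{i=1}^{n} (i + q(n - i)) = Σ_{(T,v*) ∈ 𝒜*_n} ∏_{v internal} β(v)`, where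
`β(v) = 1 + q(h_v - 1)` if `v` is on the path from the root to the distinguished
vertex and `β(v) = 2 + q(h_v - 1)` otherwise, the sum being over all pointed
André trees on `n` vertices. -/
theorem stmt9 (n : ℕ) (hn : 1 ≤ n) (q : ℚ) :
    ∏ i ∈ Finset.Icc 1 n, ((i : ℚ) + q * ((n : ℚ) - (i : ℚ)))
      = ∑ x ∈ pointedAndreTrees n, ∏ v ∈ internalsA n x.1,
          (if OnPath n x.1 x.2 v then 1 + q * ((hookA n x.1 v : ℚ) - 1)
           else 2 + q * ((hookA n x.1 v : ℚ) - 1)) := by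
  rw [sum_pointedAndreTrees_eq hn, (treeSum_and_pointedSum q Finset.univ).2, Finset.card_univ,
    Fintype.card_fin, rotheProd_zero]
end
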